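/- arXiv:2011.10323 — 3 statements merged into one kernel-verified Lean document; each statement's English description precedes it below -/
import Mathlib

section
/- The function t ↦ Γ(t)^{q²} · ∏_{j=1}^{q} Γ(tj)/Γ(t(q+j)) is non-increasing on (0,∞), for any positive integer q. -/
/-- A convex function has monotone increments. -/
lemma ConvexOn.add_le_add_of_translate {f : ℝ → ℝ} {s : Set ℝ} (hf : ConvexOn ℝ s f) {a b c : ℝ}
    (ha : a ∈ s) (hbc : b + c ∈ s) (hab : a ≤ b) (hc : 0 < c) :
    f b + f (a + c) ≤ f a + f (b + c) := by
  have hd : 0 < b - a + c := by linarith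
  have hw : c / (b - a + c) + (b - a) / (b - a + c) = 1 := by field_simp; ring
  have hw0 : 0 ≤ c / (b - a + c) := by positivity
  have hw1 : 0 ≤ (b - a) / (b - a + c) := div_nonneg (by linarith) hd.le
  have h₁ := hf.2 ha hbc hw0 hw1 hw
  have h₂ := hf.2 ha hbc hw1 hw0 (by rw [add_comm, hw])
  simp only [smul_eq_mul] at h₁ h₂
  rw [show c / (b - a + c) * a + (b - a) / (b - a + c) * (b + c) = b by field_simp; ring] at h₁
  rw [show (b - a) / (b - a + c) * a + c / (b - a + c) * (b + c) = a + c by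
    field_simp; ring] at h₂
  linear_combination h₁ + h₂ + (f a + f (b + c)) * hw

namespace ProbabilityTheory

lemma beta_comm (a b : ℝ) : beta a b = beta b a := by
  rw [beta, beta, mul_comm, add_comm]

lemma beta_le_beta_left {a a' b : ℝ} (ha : 0 < a) (hb : 0 < b) (h : a ≤ a') :
    beta a' b ≤ beta a b := by
  have ha' : 0 < a' := ha.trans_le h
  have g₁ := Real.Gamma_pos_of_pos ha
  have g₂ := Real.Gamma_pos_of_pos ha'
  have g₃ := Real.Gamma_pos_of_pos hb
  have g₄ := Real.Gamma_pos_of_pos (add_pos ha hb)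
  have g₅ := Real.Gamma_pos_of_pos (add_pos ha' hb)
  have key := Real.convexOn_log_Gamma.add_le_add_of_translate ha
    (show a' + b ∈ Set.Ioi 0 from add_pos ha' hb) h hb
  simp only [Function.comp_apply] at key
  rw [← Real.log_mul g₂.ne' g₄.ne', ← Real.log_mul g₁.ne' g₅.ne',
    Real.log_le_log_iff (by positivity) (by positivity)] at key
  rw [beta, beta, div_le_div_iff₀ g₅ g₄]
  linear_combination Real.Gamma b * key

lemma beta_le_beta {a a' b b' : ℝ} (ha : 0 < a) (hb : 0 < b) (haa' : a ≤ a') (hbb' : b ≤ b') :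
    beta a' b' ≤ beta a b :=
  (beta_le_beta_left ha (hb.trans_le hbb') haa').trans <| by
    simpa only [beta_comm a] using beta_le_beta_left hb ha hbb'

end ProbabilityTheory

open ProbabilityTheory in
lemma Real.Gamma_pow_mul_Gamma_div_Gamma_eq_prod_beta {t x : ℝ} (ht : 0 < t) (hx : 0 < x) (q : ℕ) :
    Gamma t ^ q * (Gamma (t * x) / Gamma (t * (q + x))) =
      ∏ i ∈ Finset.range q, beta t (t * (i + x)) := by
  induction q with
  | zero => simp [(Gamma_pos_of_pos (mul_pos ht hx)).ne']
  | succ n ih =>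
    have g₁ := (Gamma_pos_of_pos (show 0 < t * (n + x) by positivity)).ne'
    rw [Finset.prod_range_succ, ← ih, beta,
      show t + t * (n + x) = t * ((n + 1 : ℕ) + x) by push_cast; ring]
    field_simp
    ring

/-- The function `t ↦ Γ(t)^{q²} ∏_{j=1}^q Γ(tj)/Γ(t(q+j))` is non-increasing on `(0,∞)`. -/
theorem gamma_ratio_antitoneOn (q : ℕ) (hq : 1 ≤ q) :
    AntitoneOn (fun t : ℝ =>
      Real.Gamma t ^ (q ^ 2) *
        ∏ j ∈ Finset.Icc 1 q, Real.Gamma (t * j) / Real.Gamma (t * (q + j)))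
      (Set.Ioi 0) := by
  have hprod : ∀ t : ℝ, 0 < t → Real.Gamma t ^ (q ^ 2) *
      ∏ j ∈ Finset.Icc 1 q, Real.Gamma (t * j) / Real.Gamma (t * (q + j)) =
      ∏ j ∈ Finset.Icc 1 q, ∏ i ∈ Finset.range q, ProbabilityTheory.beta t (t * (i + j)) := by
    intro t ht
    have hconst : Real.Gamma t ^ (q ^ 2) = ∏ _j ∈ Finset.Icc 1 q, Real.Gamma t ^ q := by
      simp [sq, pow_mul]
    rw [hconst, ← Finset.prod_mul_distrib]
    refine Finset.prod_congr rfl fun j hj => ?_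
    have hj0 : (0 : ℝ) < j := Nat.cast_pos.2 (Finset.mem_Icc.1 hj).1
    exact Real.Gamma_pow_mul_Gamma_div_Gamma_eq_prod_beta ht hj0 q
  intro s (hs : 0 < s) t (ht : 0 < t) hst
  simp only [hprod s hs, hprod t ht]
  have hpos : ∀ u : ℝ, 0 < u → ∀ j ∈ Finset.Icc 1 q, ∀ i : ℕ,
      0 < u * ((i : ℝ) + j) := by
    intro u hu j hj i
    have hj0 : (0 : ℝ) < j := Nat.cast_pos.2 (Finset.mem_Icc.1 hj).1
    positivity
  refine Finset.prod_le_prod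
    (fun j hj => Finset.prod_nonneg fun i _ =>
      (ProbabilityTheory.beta_pos ht (hpos t ht j hj i)).le)
    fun j hj => Finset.prod_le_prod
      (fun i _ => (ProbabilityTheory.beta_pos ht (hpos t ht j hj i)).le)
      fun i _ => ProbabilityTheory.beta_le_beta hs (hpos s hs j hj i) hst
        (mul_le_mul_of_nonneg_right hst (by positivity))
end

section
/- Let q be a positive integer and β > 0. Then ∏_{M=1}^{q} Γ(2/β) / Γ(2M/β)² · ∫_{1 ≥ x_1 ≥ x_2 ≥ ··· ≥ x_q ≥ 0} ∏_{1≤i<j≤q}(x_i−x_j)^{4/β} ∏_{i=1}^q [x_i(1−x_i)]^{2/β−1} dx = ∏_{i=1}^q Γ((2/β)i)/Γ((2/β)(q+i)). -/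
open MeasureTheory
open Finset

lemma prod_prod_compl_abs_sub {n : ℕ} (x : Fin n → ℝ) :
    ∏ i, ∏ k ∈ {i}ᶜ, |x k - x i| = |∏ i, ∏ j ∈ Ioi i, (x j - x i)| ^ 2 := by
  rw [← prod_prod_Ioi_mul_eq_prod_prod_off_diag (fun j i => |x j - x i|), sq, ← abs_mul,
    ← prod_mul_distrib, abs_prod]
  refine prod_congr rfl fun i _ => ?_
  rw [← prod_mul_distrib, abs_prod]
  refine prod_congr rfl fun j _ => ?_
  rw [abs_mul, abs_sub_comm (x i) (x j)]

lemma abs_det_prod_compl_sub {n : ℕ} (a x : Fin n → ℝ) (hx : Function.Injective x) :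
    |(Matrix.of fun j i => ∏ k ∈ ({i}ᶜ : Finset (Fin n)), (x k - a j)).det| =
      |∏ i, ∏ j ∈ Ioi i, (a j - a i)| * |∏ i, ∏ j ∈ Ioi i, (x j - x i)| := by
  let p : Fin n → Polynomial ℝ := fun i =>
    ∏ k ∈ ({i}ᶜ : Finset (Fin n)), (Polynomial.C (x k) - Polynomial.X)
  let M : Matrix (Fin n) (Fin n) ℝ := Matrix.of fun m i => (p i).coeff m
  have hp : ∀ i, (p i).natDegree < n := by
    intro i
    have h1 : (p i).natDegree ≤ ∑ k ∈ ({i}ᶜ : Finset (Fin n)), 1 := by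
      refine (Polynomial.natDegree_prod_le _ _).trans (sum_le_sum fun k _ => ?_)
      compute_degree
    have h2 : 0 < n := i.pos
    rw [← card_eq_sum_ones, card_compl, card_singleton, Fintype.card_fin] at h1
    omega
  have key : ∀ b : Fin n → ℝ,
      (Matrix.of fun j i => ∏ k ∈ ({i}ᶜ : Finset (Fin n)), (x k - b j)).det =
        (∏ i, ∏ j ∈ Ioi i, (b j - b i)) * M.det := by
    intro b
    rw [← Matrix.det_vandermonde, ← Matrix.det_mul]
    congr 1
    ext j i
    have h := Polynomial.eval_eq_sum_range' (hp i) (b j)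
    rw [Matrix.mul_apply]
    simp only [Matrix.of_apply, Matrix.vandermonde_apply, M]
    rw [sum_range] at h
    simp only [p, Polynomial.eval_prod, Polynomial.eval_sub, Polynomial.eval_C,
      Polynomial.eval_X] at h
    rw [h]
    exact sum_congr rfl fun m _ => mul_comm _ _
  have hdiag : |(Matrix.of fun j i => ∏ k ∈ ({i}ᶜ : Finset (Fin n)), (x k - x j)).det| =
      |∏ i, ∏ j ∈ Ioi i, (x j - x i)| ^ 2 := by
    have : (Matrix.of fun j i => ∏ k ∈ ({i}ᶜ : Finset (Fin n)), (x k - x j)) =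
        Matrix.diagonal fun i => ∏ k ∈ ({i}ᶜ : Finset (Fin n)), (x k - x i) := by
      ext j i
      rcases eq_or_ne j i with rfl | h
      · simp
      · rw [Matrix.diagonal_apply_ne _ h]
        exact prod_eq_zero (mem_compl.2 (notMem_singleton.2 h)) (sub_self _)
    rw [this, Matrix.det_diagonal, ← prod_prod_compl_abs_sub, abs_prod]
    simp_rw [abs_prod]
  have hV : |∏ i, ∏ j ∈ Ioi i, (x j - x i)| ≠ 0 := by
    rw [abs_ne_zero, ← Matrix.det_vandermonde]
    exact Matrix.det_vandermonde_ne_zero_iff.2 hx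
  rw [key, abs_mul, sq] at hdiag
  rw [key, abs_mul, mul_left_cancel₀ hV hdiag]

lemma prod_erase_eq_prod_succAbove {n : ℕ} (f : Fin (n + 1) → ℝ) (j : Fin (n + 1)) :
    ∏ k ∈ univ.erase j, f k = ∏ i : Fin n, f (j.succAbove i) := by
  rw [← compl_singleton, ← Fin.image_succAbove_univ, prod_image]
  exact fun _ _ _ _ h => Fin.succAbove_right_injective h

lemma prod_prod_succAbove {n : ℕ} (f : Fin (n + 1) → Fin (n + 1) → ℝ) :
    ∏ j, ∏ k, f j (j.succAbove k) = ∏ i, ∏ j ∈ Ioi i, f i j * f j i := by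
  rw [prod_prod_Ioi_mul_eq_prod_prod_off_diag fun j i => f i j]
  refine prod_congr rfl fun j _ => ?_
  rw [compl_singleton, prod_erase_eq_prod_succAbove]

/-- The points of `ℝⁿ` that strictly interlace the decreasing sequence `a`. -/
def interlacing {n : ℕ} (a : Fin (n + 1) → ℝ) : Set (Fin n → ℝ) :=
  {x | ∀ i, a i.succ < x i ∧ x i < a i.castSucc}

/-- The residues at the points `a j` of `∏ (z - x i) / ∏ (z - a j)`. -/
noncomputable def residue {n : ℕ} (a : Fin (n + 1) → ℝ) (x : Fin n → ℝ) (j : Fin (n + 1)) : ℝ :=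
  ∏ i, (x i - a j) / (a (j.succAbove i) - a j)

section Residue

variable {n : ℕ} {a : Fin (n + 1) → ℝ} {x : Fin n → ℝ}

lemma strictAnti_of_mem_interlacing (ha : StrictAnti a) (hx : x ∈ interlacing a) :
    StrictAnti x := by
  intro i j hij
  calc x j < a j.castSucc := (hx j).2
    _ ≤ a i.succ := ha.antitone (by simpa [Fin.le_def] using hij)
    _ < x i := (hx i).1

lemma lt_of_mem_interlacing_of_lt (ha : StrictAnti a) (hx : x ∈ interlacing a)
    {i : Fin n} {j : Fin (n + 1)} (h : i.castSucc < j) : a j < x i :=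
  (ha.antitone (Fin.castSucc_lt_iff_succ_le.1 h)).trans_lt (hx i).1

lemma lt_of_mem_interlacing_of_le (ha : StrictAnti a) (hx : x ∈ interlacing a)
    {i : Fin n} {j : Fin (n + 1)} (h : j ≤ i.castSucc) : x i < a j :=
  (hx i).2.trans_le (ha.antitone h)

lemma div_pos_of_mem_interlacing (ha : StrictAnti a) (hx : x ∈ interlacing a)
    (i : Fin n) (j : Fin (n + 1)) : 0 < (x i - a j) / (a (j.succAbove i) - a j) := by
  rcases lt_or_ge i.castSucc j with h | h
  · rw [Fin.succAbove_of_castSucc_lt _ _ h]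
    exact div_pos (sub_pos.2 (lt_of_mem_interlacing_of_lt ha hx h)) (sub_pos.2 (ha h))
  · rw [Fin.succAbove_of_le_castSucc _ _ h]
    exact div_pos_of_neg_of_neg (sub_neg.2 (lt_of_mem_interlacing_of_le ha hx h))
      (sub_neg.2 (ha (Fin.le_castSucc_iff.1 h)))

lemma residue_pos (ha : StrictAnti a) (hx : x ∈ interlacing a) (j : Fin (n + 1)) :
    0 < residue a x j :=
  prod_pos fun i _ => div_pos_of_mem_interlacing ha hx i j

lemma residue_eq (j : Fin (n + 1)) :
    residue a x j = (Lagrange.nodal univ x).eval (a j) / ∏ k ∈ univ.erase j, (a j - a k) := by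
  rw [Lagrange.eval_nodal, prod_erase_eq_prod_succAbove (fun k => a j - a k), ← prod_div_distrib]
  refine prod_congr rfl fun i _ => ?_
  rw [← neg_sub, ← neg_sub (a j) (a _), neg_div_neg_eq]

lemma sum_residue (ha : Function.Injective a) : ∑ j, residue a x j = 1 := by
  have hd : (Lagrange.nodal univ x).natDegree = n := by simp
  have h := Lagrange.coeff_eq_sum (s := univ) (v := a) (P := Lagrange.nodal univ x) ha.injOn
    (by rw [Lagrange.degree_nodal]; simp; exact_mod_cast Nat.lt_succ_self n)
  simp_rw [residue_eq]
  rw [← h, card_univ, Fintype.card_fin, Nat.add_sub_cancel]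
  have := (Lagrange.nodal_monic (s := univ) (v := x)).coeff_natDegree
  rwa [hd] at this

lemma injOn_residue (ha : StrictAnti a) : Set.InjOn (residue a) (interlacing a) := by
  intro x hx y hy h
  have hP : Lagrange.nodal univ x = Lagrange.nodal univ y := by
    refine Polynomial.eq_of_degrees_lt_of_eval_index_eq univ ha.injective.injOn ?_ ?_ ?_
    · rw [Lagrange.degree_nodal]; simp; exact_mod_cast Nat.lt_succ_self n
    · rw [Lagrange.degree_nodal]; simp; exact_mod_cast Nat.lt_succ_self n
    · intro j _
      have hj := congrFun h j
      rw [residue_eq, residue_eq, div_left_inj'] at hj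
      · exact hj
      · exact prod_ne_zero_iff.2 fun k hk =>
          sub_ne_zero.2 (ha.injective.ne (ne_of_mem_erase hk).symm)
  funext i
  have h0 : (Lagrange.nodal univ x).eval (y i) = 0 := by
    rw [hP, Lagrange.eval_nodal_at_node (mem_univ i)]
  rw [Lagrange.eval_nodal, prod_eq_zero_iff] at h0
  obtain ⟨k, -, hk⟩ := h0
  have hk : y i = x k := sub_eq_zero.1 hk
  rcases lt_trichotomy i k with hik | rfl | hik
  · have h1 := lt_of_mem_interlacing_of_le ha hx (Fin.castSucc_lt_iff_succ_le.1
      (Fin.castSucc_lt_castSucc_iff.2 hik))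
    have h2 := (hy i).1
    linarith
  · exact hk.symm
  · have h1 := lt_of_mem_interlacing_of_lt ha hx (Fin.castSucc_lt_castSucc_iff.2 hik)
    have h2 := (hy i).2
    linarith

lemma prod_erase_sub_mul_prod_erase_sub_neg (ha : StrictAnti a) (i : Fin n) :
    (∏ k ∈ univ.erase i.castSucc, (a i.castSucc - a k)) *
      (∏ k ∈ univ.erase i.succ, (a i.succ - a k)) < 0 := by
  have hlt : i.castSucc < i.succ := Fin.castSucc_lt_succ
  rw [← mul_prod_erase (univ.erase i.castSucc) _ (mem_erase.2 ⟨hlt.ne', mem_univ _⟩),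
    ← mul_prod_erase (univ.erase i.succ) _ (mem_erase.2 ⟨hlt.ne, mem_univ _⟩),
    erase_right_comm, mul_mul_mul_comm, ← prod_mul_distrib]
  have h := ha hlt
  refine mul_neg_of_neg_of_pos (mul_neg_of_pos_of_neg (by linarith) (by linarith))
    (prod_pos fun k hk => ?_)
  have hk1 : k ≠ i.succ := fun h => by simp [h] at hk
  have hk2 : k ≠ i.castSucc := fun h => by simp [h] at hk
  rcases lt_or_ge i.castSucc k with h | h
  · have h' : i.succ < k := lt_of_le_of_ne (Fin.castSucc_lt_iff_succ_le.1 h) hk1.symm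
    exact mul_pos (sub_pos.2 (ha h)) (sub_pos.2 (ha h'))
  · have h' : k < i.castSucc := lt_of_le_of_ne h hk2
    exact mul_pos_of_neg_of_neg (sub_neg.2 (ha h')) (sub_neg.2 (ha (h'.trans hlt)))

lemma exists_mem_Ioo_eval_eq_zero (P : Polynomial ℝ) {s t : ℝ} (hst : s < t)
    (h : P.eval t * P.eval s < 0) : ∃ z ∈ Set.Ioo s t, P.eval z = 0 := by
  rcases mul_neg_iff.1 h with h | h
  · exact intermediate_value_Ioo hst.le P.continuous.continuousOn ⟨h.2, h.1⟩
  · exact intermediate_value_Ioo' hst.le P.continuous.continuousOn ⟨h.1, h.2⟩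

lemma exists_mem_interlacing_residue_eq (ha : StrictAnti a) (w : Fin (n + 1) → ℝ)
    (hw : ∀ j, 0 < w j) (hsum : ∑ j, w j = 1) : ∃ x ∈ interlacing a, residue a x = w := by
  set d : Fin (n + 1) → ℝ := fun j => ∏ k ∈ univ.erase j, (a j - a k) with hd
  have hd0 : ∀ j, d j ≠ 0 := fun j => prod_ne_zero_iff.2 fun k hk =>
    sub_ne_zero.2 (ha.injective.ne (ne_of_mem_erase hk).symm)
  set P := Lagrange.interpolate univ a fun j => w j * d j with hPdef
  have hP : ∀ j, P.eval (a j) = w j * d j := fun j =>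
    Lagrange.eval_interpolate_at_node _ ha.injective.injOn (mem_univ j)
  have hPdeg : P.degree < (n + 1 : ℕ) := by
    have h := Lagrange.degree_interpolate_lt (s := univ) (fun j => w j * d j) ha.injective.injOn
    rwa [card_univ, Fintype.card_fin] at h
  have hroot : ∀ i : Fin n, ∃ z ∈ Set.Ioo (a i.succ) (a i.castSucc), P.eval z = 0 := by
    intro i
    refine exists_mem_Ioo_eval_eq_zero P (ha Fin.castSucc_lt_succ) ?_
    rw [hP, hP, mul_mul_mul_comm]
    exact mul_neg_of_pos_of_neg (mul_pos (hw _) (hw _))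
      (prod_erase_sub_mul_prod_erase_sub_neg ha i)
  choose x hx hx0 using hroot
  have hxa : x ∈ interlacing a := fun i => ⟨(hx i).1, (hx i).2⟩
  have hPx : P = Lagrange.nodal univ x := by
    refine Polynomial.eq_of_degree_sub_lt_of_eval_index_eq univ
      (strictAnti_of_mem_interlacing ha hxa).injective.injOn ?_ ?_
    · rw [card_univ, Fintype.card_fin, Polynomial.degree_lt_iff_coeff_zero]
      intro m hm
      have hN : (Lagrange.nodal univ x).natDegree = n := by simp
      rw [Polynomial.coeff_sub]
      rcases hm.eq_or_lt with rfl | hm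
      · have h1 := Lagrange.coeff_eq_sum (s := univ) (v := a) (P := P) ha.injective.injOn
          (by simpa using hPdeg)
        have h2 := (Lagrange.nodal_monic (s := univ) (v := x)).coeff_natDegree
        rw [hN] at h2
        rw [card_univ, Fintype.card_fin, Nat.add_sub_cancel] at h1
        rw [h1, h2, ← hsum, sub_eq_zero]
        refine sum_congr rfl fun j _ => ?_
        rw [hP]
        exact mul_div_cancel_right₀ _ (hd0 j)
      · rw [Polynomial.coeff_eq_zero_of_natDegree_lt (p := Lagrange.nodal univ x) (by omega),
          sub_zero]
        exact (Polynomial.degree_lt_iff_coeff_zero _ _).1 hPdeg m hm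
    · intro i _
      rw [hx0, Lagrange.eval_nodal_at_node (mem_univ i)]
  refine ⟨x, hxa, funext fun j => ?_⟩
  rw [residue_eq, ← hPx, hP]
  exact mul_div_cancel_right₀ _ (hd0 j)

/-- The open standard simplex of size `c`, in coordinates that omit one vertex. -/
def openSimplex (n : ℕ) (c : ℝ) : Set (Fin n → ℝ) :=
  {w | (∀ j, 0 < w j) ∧ ∑ j, w j < c}

lemma image_residue (ha : StrictAnti a) :
    (fun x j => residue a x (Fin.succ j)) '' interlacing a = openSimplex n 1 := by
  ext w
  constructor
  · rintro ⟨x, hx, rfl⟩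
    refine ⟨fun j => residue_pos ha hx _, ?_⟩
    have h := sum_residue (x := x) ha.injective
    rw [Fin.sum_univ_succ] at h
    have := residue_pos ha hx 0
    dsimp only
    linarith
  · rintro ⟨hw, hsum⟩
    obtain ⟨x, hx, h⟩ := exists_mem_interlacing_residue_eq ha
      (Fin.cons (1 - ∑ j, w j) w : Fin (n + 1) → ℝ)
      (Fin.cases (by simpa using hsum) (by simpa using hw)) (by simp [Fin.sum_univ_succ])
    exact ⟨x, hx, by ext j; simp [h]⟩

lemma injOn_residue_succ (ha : StrictAnti a) :
    Set.InjOn (fun x j => residue a x (Fin.succ j)) (interlacing a) := by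
  intro x hx y hy h
  refine injOn_residue ha hx hy ?_
  have hs : ∀ j : Fin n, residue a x j.succ = residue a y j.succ := congrFun h
  have h1 := sum_residue (x := x) ha.injective
  have h2 := sum_residue (x := y) ha.injective
  rw [Fin.sum_univ_succ] at h1 h2
  funext j
  refine Fin.cases ?_ hs j
  simp_rw [hs] at h1
  linarith

end Residue

lemma measurableSet_interlacing {n : ℕ} (a : Fin (n + 1) → ℝ) :
    MeasurableSet (interlacing a) := by
  refine (MeasurableSet.iInter fun i => ?_).congr
    (s := ⋂ i, {x | a i.succ < x i ∧ x i < a i.castSucc}) ?_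
  · exact (measurableSet_lt measurable_const (measurable_pi_apply i)).inter
      (measurableSet_lt (measurable_pi_apply i) measurable_const)
  · ext x
    simp [interlacing]

lemma prod_prod_Ioi_succ {n : ℕ} (f : Fin (n + 1) → Fin (n + 1) → ℝ) :
    ∏ i, ∏ j ∈ Ioi i, f i j =
      (∏ j : Fin n, f 0 j.succ) * ∏ i : Fin n, ∏ j ∈ Ioi i, f i.succ j.succ := by
  rw [Fin.prod_univ_succ, Fin.Ioi_zero_eq_map, prod_map]
  congr 1
  refine prod_congr rfl fun i _ => ?_
  rw [← Fin.map_succEmb_Ioi, prod_map]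
  rfl

/-- The product of the differences `x i - x j` over `i < j`. -/
noncomputable def gapProd {n : ℕ} (x : Fin n → ℝ) : ℝ := ∏ i, ∏ j ∈ Ioi i, (x i - x j)

lemma gapProd_pos {n : ℕ} {x : Fin n → ℝ} (hx : StrictAnti x) : 0 < gapProd x :=
  prod_pos fun _ _ => prod_pos fun _ hj => sub_pos.2 (hx (mem_Ioi.1 hj))

lemma abs_prod_prod_Ioi_sub {n : ℕ} {x : Fin n → ℝ} (hx : StrictAnti x) :
    |∏ i, ∏ j ∈ Ioi i, (x j - x i)| = gapProd x := by
  rw [← abs_of_pos (gapProd_pos hx), gapProd]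
  simp_rw [abs_prod, abs_sub_comm]

lemma gapProd_succ {n : ℕ} (a : Fin (n + 1) → ℝ) :
    gapProd a = (∏ j : Fin n, (a 0 - a j.succ)) * gapProd (fun j : Fin n => a j.succ) :=
  prod_prod_Ioi_succ fun i j => a i - a j

lemma prod_prod_Ioi_sub_rpow {n : ℕ} {x : Fin n → ℝ} (hx : StrictAnti x) (c : ℝ) :
    ∏ i, ∏ j ∈ Ioi i, (x i - x j) ^ c = gapProd x ^ c := by
  rw [gapProd, ← Real.finsetProd_rpow _ _
    (fun i _ => prod_nonneg fun j hj => (sub_pos.2 (hx (mem_Ioi.1 hj))).le)]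
  exact prod_congr rfl fun i _ => Real.finsetProd_rpow _ _
    (fun j hj => (sub_pos.2 (hx (mem_Ioi.1 hj))).le) _

/-- The derivative of the map sending `x` to its residues at `a 1, …, a n`, as a matrix. -/
noncomputable def residueJacobian {n : ℕ} (a : Fin (n + 1) → ℝ) (x : Fin n → ℝ) :
    Matrix (Fin n) (Fin n) ℝ :=
  Matrix.of fun j i => (∏ k : Fin n, (a (j.succ.succAbove k) - a j.succ))⁻¹ *
    ∏ k ∈ ({i}ᶜ : Finset (Fin n)), (x k - a j.succ)

lemma hasFDerivAt_residue {n : ℕ} (a : Fin (n + 1) → ℝ) (x : Fin n → ℝ) :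
    HasFDerivAt (fun x j => residue a x (Fin.succ j))
      (LinearMap.toContinuousLinearMap (Matrix.toLin' (residueJacobian a x))) x := by
  rw [hasFDerivAt_pi']
  intro j
  have h : HasFDerivAt (fun x : Fin n → ℝ => ∏ i, (x i - a j.succ))
      (∑ i, (∏ k ∈ univ.erase i, (x k - a j.succ)) •
        ContinuousLinearMap.proj (R := ℝ) (φ := fun _ : Fin n => ℝ) i) x :=
    HasFDerivAt.finsetProd fun i _ => (hasFDerivAt_apply i x).sub_const _
  have h2 := h.const_mul (∏ k : Fin n, (a (j.succ.succAbove k) - a j.succ))⁻¹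
  refine (h2.congr_fderiv ?_).congr_of_eventuallyEq (.of_forall fun y => ?_)
  · ext v
    simp [residueJacobian, Matrix.mulVec, dotProduct, mul_sum, mul_assoc, compl_singleton]
  · simp only [residue, prod_div_distrib]
    rw [div_eq_inv_mul]

lemma abs_det_residueJacobian {n : ℕ} {a : Fin (n + 1) → ℝ} {x : Fin n → ℝ} (ha : StrictAnti a)
    (hx : StrictAnti x) : |(residueJacobian a x).det| = gapProd x / gapProd a := by
  have ha' : StrictAnti fun j : Fin n => a j.succ := fun i j h => ha (Fin.succ_lt_succ_iff.2 h)
  have h1 : (residueJacobian a x).det =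
      (∏ j : Fin n, (∏ k : Fin n, (a (j.succ.succAbove k) - a j.succ))⁻¹) *
      (Matrix.of fun j i => ∏ k ∈ ({i}ᶜ : Finset (Fin n)), (x k - a j.succ)).det :=
    Matrix.det_mul_column _ _
  have h2 : |∏ j : Fin n, ∏ k : Fin n, (a (j.succ.succAbove k) - a j.succ)| =
      gapProd a * gapProd fun j : Fin n => a j.succ := by
    have h3 := prod_prod_succAbove fun j l => |a l - a j|
    rw [Fin.prod_univ_succ] at h3
    have h4 : ∏ k : Fin n, |a (Fin.succAbove 0 k) - a 0| = ∏ k : Fin n, (a 0 - a k.succ) := by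
      refine prod_congr rfl fun k _ => ?_
      rw [Fin.succAbove_zero, abs_sub_comm, abs_of_pos (sub_pos.2 (ha (Fin.succ_pos k)))]
    have h5 : ∏ i, ∏ j ∈ Ioi i, |a j - a i| * |a i - a j| = gapProd a * gapProd a := by
      rw [gapProd, ← prod_mul_distrib]
      refine prod_congr rfl fun i _ => ?_
      rw [← prod_mul_distrib]
      refine prod_congr rfl fun j hj => ?_
      rw [abs_sub_comm (a j), abs_of_pos (sub_pos.2 (ha (mem_Ioi.1 hj)))]
    rw [h5, h4] at h3
    nth_rewrite 2 [gapProd_succ a] at h3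
    rw [mul_left_comm] at h3
    simp_rw [abs_prod]
    exact mul_left_cancel₀
      (prod_pos fun k _ => sub_pos.2 (ha (Fin.succ_pos k))).ne' h3
  rw [h1, prod_inv_distrib, abs_mul, abs_inv, h2,
    abs_det_prod_compl_sub (fun j => a j.succ) x hx.injective, abs_prod_prod_Ioi_sub hx,
    abs_prod_prod_Ioi_sub ha']
  have := (gapProd_pos ha).ne'
  have := (gapProd_pos ha').ne'
  field_simp

lemma lintegral_rpow_mul_sub_rpow {s t c : ℝ} (hs : 0 < s) (ht : 0 < t) (hc : 0 < c) :
    ∫⁻ u in Set.Ioo 0 c, ENNReal.ofReal (u ^ (s - 1) * (c - u) ^ (t - 1)) =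
      ENNReal.ofReal (Real.Gamma s * Real.Gamma t / Real.Gamma (s + t) * c ^ (s + t - 1)) := by
  have hB := ProbabilityTheory.beta_pos hs ht
  have hunit : ∫⁻ u in Set.Ioo (0 : ℝ) 1, ENNReal.ofReal (u ^ (s - 1) * (1 - u) ^ (t - 1)) =
      ENNReal.ofReal (ProbabilityTheory.beta s t) := by
    have h := ProbabilityTheory.lintegral_betaPDF_eq_one hs ht
    rw [ProbabilityTheory.lintegral_betaPDF] at h
    simp_rw [mul_assoc, ENNReal.ofReal_mul (one_div_pos.2 hB).le] at h
    rw [lintegral_const_mul' _ _ ENNReal.ofReal_ne_top] at h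
    rw [← mul_one (ENNReal.ofReal (ProbabilityTheory.beta s t)), ← h, ← mul_assoc,
      ← ENNReal.ofReal_mul hB.le, mul_one_div_cancel hB.ne', ENNReal.ofReal_one, one_mul]
  have himg : (fun u : ℝ => c * u) '' Set.Ioo 0 1 = Set.Ioo 0 c := by
    rw [Set.image_mul_left_Ioo hc, mul_zero, mul_one]
  rw [← himg, lintegral_image_eq_lintegral_abs_deriv_mul measurableSet_Ioo
    (f' := fun _ => c) (fun u _ => by simpa using ((hasDerivAt_id u).const_mul c).hasDerivWithinAt)
    (mul_right_injective₀ hc.ne').injOn]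
  change _ = ENNReal.ofReal (ProbabilityTheory.beta s t * _)
  rw [mul_comm, ENNReal.ofReal_mul (by positivity), ← hunit,
    ← lintegral_const_mul' _ _ ENNReal.ofReal_ne_top]
  refine setLIntegral_congr_fun measurableSet_Ioo fun u hu => ?_
  have h1 : 0 < 1 - u := sub_pos.2 hu.2
  rw [← ENNReal.ofReal_mul (abs_nonneg _), ← ENNReal.ofReal_mul (by positivity), abs_of_pos hc,
    show c - c * u = c * (1 - u) by ring, Real.mul_rpow hc.le hu.1.le,
    Real.mul_rpow hc.le h1.le]
  have h2 : c ^ (s + t - 1) = c * c ^ (s - 1) * c ^ (t - 1) := by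
    rw [show s + t - 1 = 1 + (s - 1) + (t - 1) by ring, Real.rpow_add hc, Real.rpow_add hc,
      Real.rpow_one]
  rw [h2]
  congr 1
  ring

lemma measurableSet_openSimplex (n : ℕ) (c : ℝ) : MeasurableSet (openSimplex n c) := by
  refine MeasurableSet.inter (s₁ := {w : Fin n → ℝ | ∀ j, 0 < w j})
    (s₂ := {w : Fin n → ℝ | ∑ j, w j < c}) ?_
    (measurableSet_lt (by fun_prop) measurable_const)
  rw [Set.ofPred_forall]
  exact MeasurableSet.iInter fun j => measurableSet_lt measurable_const (measurable_pi_apply j)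

lemma openSimplex_eq_empty {n : ℕ} {c : ℝ} (hc : c ≤ 0) : openSimplex n c = ∅ := by
  refine Set.eq_empty_of_forall_notMem fun w hw => ?_
  have := sum_nonneg fun j (_ : j ∈ univ) => (hw.1 j).le
  linarith [hw.2]

lemma cons_mem_openSimplex_iff {n : ℕ} {c u : ℝ} {w : Fin n → ℝ} :
    (Fin.cons u w : Fin (n + 1) → ℝ) ∈ openSimplex (n + 1) c ↔
      0 < u ∧ w ∈ openSimplex n (c - u) := by
  simp [openSimplex, Fin.forall_fin_succ, Fin.sum_univ_succ, and_assoc, lt_sub_iff_add_lt']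

lemma lintegral_fin_succ {n : ℕ} (f : (Fin (n + 1) → ℝ) → ENNReal) (hf : Measurable f) :
    ∫⁻ w, f w = ∫⁻ u, ∫⁻ w : Fin n → ℝ, f (Fin.cons u w) := by
  have h := (volume_preserving_piFinSuccAbove (fun _ : Fin (n + 1) => ℝ) 0).symm
  rw [← h.lintegral_comp hf, Measure.volume_eq_prod, lintegral_prod]
  · simp [MeasurableEquiv.piFinSuccAbove]
    rfl
  · exact (hf.comp (MeasurableEquiv.measurable _)).aemeasurable

/-- Dirichlet's integral over a simplex. -/
lemma lintegral_openSimplex {n : ℕ} (s : Fin n → ℝ) (hs : ∀ j, 0 < s j) {t : ℝ} (ht : 0 < t)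
    {c : ℝ} (hc : 0 < c) :
    ∫⁻ w in openSimplex n c,
        ENNReal.ofReal ((∏ j, w j ^ (s j - 1)) * (c - ∑ j, w j) ^ (t - 1)) =
      ENNReal.ofReal ((∏ j, Real.Gamma (s j)) * Real.Gamma t / Real.Gamma (t + ∑ j, s j) *
        c ^ (t + ∑ j, s j - 1)) := by
  induction n generalizing c with
  | zero =>
    have : openSimplex 0 c = Set.univ := by ext w; simp [openSimplex, hc]
    rw [this, Measure.restrict_univ, lintegral_unique]
    have := (Real.Gamma_pos_of_pos ht).ne'
    simp [this, volume_pi]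
  | succ n ih =>
    have hS : 0 < t + ∑ j : Fin n, s j.succ :=
      add_pos_of_pos_of_nonneg ht (sum_nonneg fun j _ => (hs _).le)
    have hG : ∀ j, 0 < Real.Gamma (s j) := fun j => Real.Gamma_pos_of_pos (hs j)
    have hGt := Real.Gamma_pos_of_pos ht
    have hGS := Real.Gamma_pos_of_pos hS
    have hK : 0 ≤ (∏ j : Fin n, Real.Gamma (s j.succ)) * Real.Gamma t /
        Real.Gamma (t + ∑ j : Fin n, s j.succ) :=
      div_nonneg (mul_nonneg (prod_nonneg fun j _ => (hG _).le) hGt.le) hGS.le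
    rw [← lintegral_indicator (measurableSet_openSimplex _ _), lintegral_fin_succ]
    swap
    · exact Measurable.indicator (by fun_prop) (measurableSet_openSimplex _ _)
    have key : ∀ u : ℝ, ∫⁻ w : Fin n → ℝ, (openSimplex (n + 1) c).indicator
          (fun w => ENNReal.ofReal ((∏ j, w j ^ (s j - 1)) * (c - ∑ j, w j) ^ (t - 1)))
          (Fin.cons u w) =
        (Set.Ioo 0 c).indicator (fun u => ENNReal.ofReal
          ((∏ j : Fin n, Real.Gamma (s j.succ)) * Real.Gamma t /
            Real.Gamma (t + ∑ j : Fin n, s j.succ)) *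
          ENNReal.ofReal (u ^ (s 0 - 1) * (c - u) ^ (t + ∑ j : Fin n, s j.succ - 1))) u := by
      intro u
      by_cases hu : u ∈ Set.Ioo 0 c
      · have hcu : 0 < c - u := sub_pos.2 hu.2
        have hu0 : 0 ≤ u ^ (s 0 - 1) := Real.rpow_nonneg hu.1.le _
        rw [Set.indicator_of_mem hu, ENNReal.ofReal_mul hu0, mul_left_comm,
          ← ENNReal.ofReal_mul hK, ← ih (fun j => s j.succ) (fun j => hs _) hcu,
          ← lintegral_indicator (measurableSet_openSimplex _ _),
          ← lintegral_const_mul' _ _ ENNReal.ofReal_ne_top]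
        refine lintegral_congr fun w => ?_
        by_cases hw : w ∈ openSimplex n (c - u)
        · rw [Set.indicator_of_mem hw, Set.indicator_of_mem (cons_mem_openSimplex_iff.2 ⟨hu.1, hw⟩),
            ← ENNReal.ofReal_mul hu0]
          simp [Fin.prod_univ_succ, Fin.sum_univ_succ, mul_assoc, sub_sub]
        · rw [Set.indicator_of_notMem hw, mul_zero, Set.indicator_of_notMem]
          exact fun h => hw (cons_mem_openSimplex_iff.1 h).2
      · rw [Set.indicator_of_notMem hu]
        refine (lintegral_congr fun w => ?_).trans lintegral_zero
        refine Set.indicator_of_notMem (fun h => hu ?_) _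
        have h := cons_mem_openSimplex_iff.1 h
        refine ⟨h.1, ?_⟩
        by_contra! hcu
        rw [openSimplex_eq_empty (by linarith)] at h
        exact h.2
    simp_rw [key]
    rw [lintegral_indicator measurableSet_Ioo, lintegral_const_mul' _ _ ENNReal.ofReal_ne_top,
      lintegral_rpow_mul_sub_rpow (hs 0) hS hc, ← ENNReal.ofReal_mul hK]
    rw [Fin.prod_univ_succ, Fin.sum_univ_succ, add_left_comm]
    congr 1
    field_simp

lemma prod_rpow_residue {n : ℕ} {a : Fin (n + 1) → ℝ} {x : Fin n → ℝ} (ha : StrictAnti a)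
    (s : Fin (n + 1) → ℝ) :
    gapProd x * ∏ j, ∏ i, |x i - a j| ^ (s j - 1) =
      (∏ i, ∏ j ∈ Ioi i, (a i - a j) ^ (s i + s j - 1)) *
        (gapProd x / gapProd a * ∏ j, |residue a x j| ^ (s j - 1)) := by
  have h1 : ∀ j, |residue a x j| ^ (s j - 1) =
      (∏ i, |x i - a j| ^ (s j - 1)) / ∏ i, |a (j.succAbove i) - a j| ^ (s j - 1) := by
    intro j
    rw [residue, abs_prod, ← Real.finsetProd_rpow _ _ (fun i _ => abs_nonneg _), ← prod_div_distrib]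
    exact prod_congr rfl fun i _ => by
      rw [abs_div, Real.div_rpow (abs_nonneg _) (abs_nonneg _)]
  have h2 : (∏ j, ∏ i, |a (j.succAbove i) - a j| ^ (s j - 1)) * gapProd a =
      ∏ i, ∏ j ∈ Ioi i, (a i - a j) ^ (s i + s j - 1) := by
    rw [prod_prod_succAbove fun j l => |a l - a j| ^ (s j - 1), gapProd, ← prod_mul_distrib]
    refine prod_congr rfl fun i _ => ?_
    rw [← prod_mul_distrib]
    refine prod_congr rfl fun j hj => ?_
    have h := sub_pos.2 (ha (mem_Ioi.1 hj))
    rw [abs_sub_comm, abs_of_pos h, ← Real.rpow_add h, ← Real.rpow_add_one h.ne']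
    ring_nf
  have h3 : ∏ j, ∏ i, |a (j.succAbove i) - a j| ^ (s j - 1) ≠ 0 :=
    prod_ne_zero_iff.2 fun j _ => prod_ne_zero_iff.2 fun i _ => (Real.rpow_pos_of_pos
      (abs_pos.2 (sub_ne_zero.2 (ha.injective.ne (Fin.succAbove_ne j i)))) _).ne'
  have h4 := (gapProd_pos ha).ne'
  simp_rw [h1]
  rw [← h2, prod_div_distrib]
  field_simp

/-- The Dixon–Anderson integral. -/
theorem lintegral_interlacing {n : ℕ} {a : Fin (n + 1) → ℝ} (ha : StrictAnti a)
    (s : Fin (n + 1) → ℝ) (hs : ∀ j, 0 < s j) :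
    ∫⁻ x in interlacing a, ENNReal.ofReal (gapProd x * ∏ j, ∏ i, |x i - a j| ^ (s j - 1)) =
      ENNReal.ofReal ((∏ j, Real.Gamma (s j)) / Real.Gamma (∑ j, s j) *
        ∏ i, ∏ j ∈ Ioi i, (a i - a j) ^ (s i + s j - 1)) := by
  have hK : 0 ≤ ∏ i, ∏ j ∈ Ioi i, (a i - a j) ^ (s i + s j - 1) :=
    prod_nonneg fun i _ => prod_nonneg fun j hj =>
      Real.rpow_nonneg (sub_pos.2 (ha (mem_Ioi.1 hj))).le _
  simp_rw [prod_rpow_residue ha s, ENNReal.ofReal_mul hK]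
  rw [lintegral_const_mul' _ _ ENNReal.ofReal_ne_top, mul_comm _ (∏ i, ∏ j ∈ Ioi i, _),
    ENNReal.ofReal_mul hK]
  congr 1
  have h := lintegral_openSimplex (fun j => s (Fin.succ j)) (fun j => hs _) (hs 0) one_pos
  rw [← image_residue ha, lintegral_image_eq_lintegral_abs_det_fderiv_mul volume
    (measurableSet_interlacing a) (fun x _ => (hasFDerivAt_residue a x).hasFDerivWithinAt)
    (injOn_residue_succ ha), Real.one_rpow, mul_one, mul_comm (∏ j : Fin n, _),
    ← Fin.prod_univ_succ (fun j => Real.Gamma (s j)), ← Fin.sum_univ_succ] at h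
  rw [← h]
  refine setLIntegral_congr_fun (measurableSet_interlacing a) fun x hx => ?_
  have h1 := sum_residue (x := x) ha.injective
  rw [Fin.sum_univ_succ] at h1
  rw [LinearMap.det_toContinuousLinearMap, LinearMap.det_toLin',
    abs_det_residueJacobian ha (strictAnti_of_mem_interlacing ha hx),
    ← ENNReal.ofReal_mul (div_nonneg
      (gapProd_pos (strictAnti_of_mem_interlacing ha hx)).le (gapProd_pos ha).le),
    ← eq_sub_of_add_eq h1, mul_comm (∏ j : Fin n, _),
    ← Fin.prod_univ_succ (fun j => residue a x j ^ (s j - 1))]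
  simp_rw [abs_of_pos (residue_pos ha hx _)]

lemma prod_prod_Ioi_castSucc {n : ℕ} (f : Fin (n + 1) → Fin (n + 1) → ℝ) :
    ∏ i, ∏ j ∈ Ioi i, f i j =
      (∏ i : Fin n, f i.castSucc (Fin.last n)) *
        ∏ i : Fin n, ∏ j ∈ Ioi i, f i.castSucc j.castSucc := by
  have h : ∀ i : Fin n, Ioi i.castSucc = cons (Fin.last n) ((Ioi i).map Fin.castSuccEmb)
      (by simp) := by
    intro i
    ext k
    refine Fin.lastCases ?_ (fun k => ?_) k
    · simp [Fin.castSucc_lt_last]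
    · simpa using fun _ => Fin.le_last k.castSucc
  have hlast : Ioi (Fin.last n) = ∅ := by
    ext k
    simp [Fin.le_last]
  rw [Fin.prod_univ_castSucc, hlast, prod_empty, mul_one, ← prod_mul_distrib]
  refine prod_congr rfl fun i _ => ?_
  rw [h, prod_cons, prod_map]
  rfl

/-- The points of the open unit cube with decreasing coordinates. -/
def openChamber (n : ℕ) : Set (Fin n → ℝ) :=
  {x | StrictAnti x ∧ ∀ i, 0 < x i ∧ x i < 1}

lemma measurableSet_openChamber (n : ℕ) : MeasurableSet (openChamber n) := by
  have h : openChamber n = (⋂ i : Fin n, ⋂ j : Fin n, ⋂ _ : i < j, {x | x j < x i}) ∩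
      ⋂ i : Fin n, {x | 0 < x i} ∩ {x | x i < 1} := by
    ext x
    simp [openChamber, StrictAnti]
  rw [h]
  refine MeasurableSet.inter ?_ (MeasurableSet.iInter fun i => ?_)
  · exact MeasurableSet.iInter fun i => MeasurableSet.iInter fun j => MeasurableSet.iInter
      fun _ => measurableSet_lt (measurable_pi_apply j) (measurable_pi_apply i)
  · exact (measurableSet_lt measurable_const (measurable_pi_apply i)).inter
      (measurableSet_lt (measurable_pi_apply i) measurable_const)

/-- The sequence `1, y 0, …, y (n - 1), 0`. -/
def withEndpoints {n : ℕ} (y : Fin n → ℝ) : Fin (n + 2) → ℝ :=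
  Fin.cons 1 (Fin.snoc y 0 : Fin (n + 1) → ℝ)

lemma strictAnti_withEndpoints {n : ℕ} {y : Fin n → ℝ} (hy : y ∈ openChamber n) :
    StrictAnti (withEndpoints y) := by
  intro i
  refine Fin.cases ?_ (fun i => ?_) i
  · intro j
    refine Fin.cases (fun h => absurd h (lt_irrefl _)) (fun j _ => ?_) j
    refine Fin.lastCases ?_ (fun j => ?_) j
    · simp [withEndpoints]
    · simpa [withEndpoints] using (hy.2 j).2
  · intro j
    refine Fin.cases (fun h => absurd h (by simp)) (fun j h => ?_) j
    have h := Fin.succ_lt_succ_iff.1 h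
    revert h
    refine Fin.lastCases (fun h => absurd h (Fin.le_last _).not_gt) (fun i => ?_) i
    refine Fin.lastCases (fun _ => ?_) (fun j h => ?_) j
    · simpa [withEndpoints] using (hy.2 i).1
    · simpa [withEndpoints] using hy.1 (Fin.castSucc_lt_castSucc_iff.1 h)

lemma mem_interlacing_withEndpoints {n : ℕ} {x : Fin (n + 1) → ℝ} {y : Fin n → ℝ} :
    x ∈ interlacing (withEndpoints y) ↔
      y ∈ interlacing x ∧ 0 < x (Fin.last n) ∧ x 0 < 1 := by
  have h1 : (∀ i : Fin (n + 1), withEndpoints y i.succ < x i) ↔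
      (∀ k : Fin n, y k < x k.castSucc) ∧ 0 < x (Fin.last n) := by
    rw [Fin.forall_fin_succ']
    simp [withEndpoints]
  have h2 : (∀ i : Fin (n + 1), x i < withEndpoints y i.castSucc) ↔
      x 0 < 1 ∧ ∀ k : Fin n, x k.succ < y k := by
    rw [Fin.forall_fin_succ]
    simp [withEndpoints]
  simp only [interlacing, Set.mem_ofPred_eq, forall_and]
  rw [h1, h2]
  tauto

lemma mem_openChamber_and_mem_interlacing_iff {n : ℕ} {x : Fin (n + 1) → ℝ} {y : Fin n → ℝ} :
    x ∈ openChamber (n + 1) ∧ y ∈ interlacing x ↔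
      y ∈ openChamber n ∧ x ∈ interlacing (withEndpoints y) := by
  constructor
  · rintro ⟨hx, hy⟩
    refine ⟨⟨strictAnti_of_mem_interlacing hx.1 hy, fun i => ⟨?_, ?_⟩⟩,
      mem_interlacing_withEndpoints.2 ⟨hy, (hx.2 _).1, (hx.2 _).2⟩⟩
    · exact (hx.2 _).1.trans (hy i).1
    · exact (hy i).2.trans (hx.2 _).2
  · rintro ⟨hy, hx⟩
    have h := mem_interlacing_withEndpoints.1 hx
    have hanti := strictAnti_of_mem_interlacing (strictAnti_withEndpoints hy) hx
    exact ⟨⟨hanti, fun i => ⟨h.2.1.trans_le (hanti.antitone (Fin.le_last i)),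
      (hanti.antitone (Fin.zero_le i)).trans_lt h.2.2⟩⟩, h.1⟩

/-- Selberg's integral over the chamber of decreasing sequences. -/
noncomputable def chamberIntegral (n : ℕ) (γ a b : ℝ) : ENNReal :=
  ∫⁻ x in openChamber n,
    ENNReal.ofReal (gapProd x ^ (2 * γ) * ∏ i, (x i ^ (a - 1) * (1 - x i) ^ (b - 1)))

/-- The weight on interlacing pairs whose two marginals are Selberg densities. -/
noncomputable def pairWeight {n : ℕ} (γ a b : ℝ) (x : Fin (n + 1) → ℝ) (y : Fin n → ℝ) : ℝ :=
  gapProd x * gapProd y * (∏ j, ∏ i, |x i - y j| ^ (γ - 1)) *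
    ∏ i, (x i ^ (a - 1) * (1 - x i) ^ (b - 1))

lemma lintegral_pairWeight_right {n : ℕ} {γ : ℝ} (hγ : 0 < γ) (a b : ℝ) {x : Fin (n + 1) → ℝ}
    (hx : x ∈ openChamber (n + 1)) :
    ∫⁻ y in interlacing x, ENNReal.ofReal (pairWeight γ a b x y) =
      ENNReal.ofReal (Real.Gamma γ ^ (n + 1) / Real.Gamma ((n + 1) * γ)) *
        ENNReal.ofReal (gapProd x ^ (2 * γ) * ∏ i, (x i ^ (a - 1) * (1 - x i) ^ (b - 1))) := by
  have hg := gapProd_pos hx.1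
  have hw : 0 ≤ ∏ i, (x i ^ (a - 1) * (1 - x i) ^ (b - 1)) :=
    prod_nonneg fun i _ => mul_nonneg (Real.rpow_nonneg (hx.2 i).1.le _)
      (Real.rpow_nonneg (sub_pos.2 (hx.2 i).2).le _)
  have hΓ := Real.Gamma_pos_of_pos hγ
  have hΓ' : 0 < Real.Gamma ((n + 1) * γ) := Real.Gamma_pos_of_pos (by positivity)
  have h := lintegral_interlacing hx.1 (fun _ => γ) (fun _ => hγ)
  have hgap : ∏ i, ∏ j ∈ Ioi i, (x i - x j) ^ (γ + γ - 1) = gapProd x ^ (2 * γ - 1) := by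
    rw [prod_prod_Ioi_sub_rpow hx.1, two_mul]
  rw [hgap, prod_const, card_univ, Fintype.card_fin, sum_const, card_univ, Fintype.card_fin,
    nsmul_eq_mul, Nat.cast_add_one] at h
  have hpw : ∀ y, pairWeight γ a b x y =
      (gapProd x * ∏ i, (x i ^ (a - 1) * (1 - x i) ^ (b - 1))) *
        (gapProd y * ∏ j, ∏ i, |y i - x j| ^ (γ - 1)) := by
    intro y
    rw [pairWeight, prod_comm]
    simp_rw [abs_sub_comm (y _)]
    ring
  simp_rw [hpw, ENNReal.ofReal_mul (mul_nonneg hg.le hw)]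
  rw [lintegral_const_mul' _ _ ENNReal.ofReal_ne_top, h, ← ENNReal.ofReal_mul (by positivity),
    ← ENNReal.ofReal_mul (by positivity)]
  congr 1
  rw [show 2 * γ = 2 * γ - 1 + 1 by ring, Real.rpow_add_one hg.ne']
  ring_nf

lemma lintegral_pairWeight_left {n : ℕ} {γ a b : ℝ} (hγ : 0 < γ) (ha : 0 < a) (hb : 0 < b)
    {y : Fin n → ℝ} (hy : y ∈ openChamber n) :
    ∫⁻ x in interlacing (withEndpoints y), ENNReal.ofReal (pairWeight γ a b x y) =
      ENNReal.ofReal (Real.Gamma a * Real.Gamma b * Real.Gamma γ ^ n /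
          Real.Gamma (a + b + n * γ)) *
        ENNReal.ofReal (gapProd y ^ (2 * γ) *
          ∏ i, (y i ^ (a + γ - 1) * (1 - y i) ^ (b + γ - 1))) := by
  have hg := gapProd_pos hy.1
  have hΓ := Real.Gamma_pos_of_pos hγ
  have hΓa := Real.Gamma_pos_of_pos ha
  have hΓb := Real.Gamma_pos_of_pos hb
  have hΓ' : 0 < Real.Gamma (a + b + n * γ) := Real.Gamma_pos_of_pos (by positivity)
  have hsplit : ∀ f : Fin (n + 2) → ℝ,
      ∏ j, f j = f 0 * ((∏ j : Fin n, f j.castSucc.succ) * f (Fin.last n).succ) := by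
    intro f
    rw [Fin.prod_univ_succ, Fin.prod_univ_castSucc]
  set s : Fin (n + 2) → ℝ := Fin.cons b (Fin.snoc (fun _ => γ) a : Fin (n + 1) → ℝ) with hs
  have hs0 : ∀ j, 0 < s j := by
    intro j
    refine Fin.cases hb (fun j => ?_) j
    refine Fin.lastCases ?_ (fun j => ?_) j
    · simpa [hs] using ha
    · simpa [hs] using hγ
  have hgap : ∏ i, ∏ j ∈ Ioi i, (y i - y j) ^ (γ + γ - 1) = gapProd y ^ (2 * γ - 1) := by
    rw [prod_prod_Ioi_sub_rpow hy.1, two_mul]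
  have hpw : ∀ x ∈ interlacing (withEndpoints y), ENNReal.ofReal (pairWeight γ a b x y) =
      ENNReal.ofReal (gapProd y) * ENNReal.ofReal
        (gapProd x * ∏ j, ∏ i, |x i - withEndpoints y j| ^ (s j - 1)) := by
    intro x hx
    have hxC := (mem_openChamber_and_mem_interlacing_iff.2 ⟨hy, hx⟩).1
    rw [hsplit, ← ENNReal.ofReal_mul hg.le]
    simp only [hs, withEndpoints, Fin.cons_zero, Fin.cons_succ, Fin.snoc_castSucc, Fin.snoc_last,
      sub_zero]
    have h1 : ∏ i, |x i - 1| ^ (b - 1) = ∏ i, (1 - x i) ^ (b - 1) :=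
      prod_congr rfl fun i _ => by rw [abs_sub_comm, abs_of_pos (sub_pos.2 (hxC.2 i).2)]
    have h2 : ∏ i, |x i| ^ (a - 1) = ∏ i, x i ^ (a - 1) :=
      prod_congr rfl fun i _ => by rw [abs_of_pos (hxC.2 i).1]
    rw [h1, h2, pairWeight, prod_mul_distrib]
    congr 1
    ring
  rw [setLIntegral_congr_fun (measurableSet_interlacing _) hpw,
    lintegral_const_mul' _ _ ENNReal.ofReal_ne_top,
    lintegral_interlacing (strictAnti_withEndpoints hy) s hs0, ← ENNReal.ofReal_mul hg.le,
    ← ENNReal.ofReal_mul (by positivity), hsplit, prod_prod_Ioi_succ, prod_prod_Ioi_castSucc,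
    Fin.sum_univ_succ, Fin.sum_univ_castSucc, Fin.prod_univ_castSucc]
  simp only [hs, withEndpoints, Fin.cons_zero, Fin.cons_succ, Fin.snoc_castSucc, Fin.snoc_last,
    hgap, prod_const, sum_const, card_univ, Fintype.card_fin, nsmul_eq_mul, sub_zero,
    Real.one_rpow, mul_one]
  rw [show 2 * γ = 2 * γ - 1 + 1 by ring, Real.rpow_add_one hg.ne', prod_mul_distrib,
    show b + (n * γ + a) = a + b + n * γ by ring, add_comm γ a]
  congr 1
  ring_nf

lemma measurableSet_interlacing_pairs (n : ℕ) :
    MeasurableSet {p : (Fin (n + 1) → ℝ) × (Fin n → ℝ) |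
      p.1 ∈ openChamber (n + 1) ∧ p.2 ∈ interlacing p.1} := by
  refine (measurable_fst (measurableSet_openChamber _)).inter
    (s₂ := {p : (Fin (n + 1) → ℝ) × (Fin n → ℝ) | p.2 ∈ interlacing p.1}) ?_
  have h : {p : (Fin (n + 1) → ℝ) × (Fin n → ℝ) | p.2 ∈ interlacing p.1} =
      ⋂ i : Fin n, {p | p.1 i.succ < p.2 i} ∩ {p | p.2 i < p.1 i.castSucc} := by
    ext p
    simp [interlacing]
  rw [h]
  exact MeasurableSet.iInter fun i => (measurableSet_lt (by fun_prop) (by fun_prop)).inter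
    (measurableSet_lt (by fun_prop) (by fun_prop))

/-- Anderson's recursion for Selberg's integral. -/
theorem chamberIntegral_succ (n : ℕ) {γ a b : ℝ} (hγ : 0 < γ) (ha : 0 < a) (hb : 0 < b) :
    ENNReal.ofReal (Real.Gamma γ ^ (n + 1) / Real.Gamma ((n + 1) * γ)) *
        chamberIntegral (n + 1) γ a b =
      ENNReal.ofReal (Real.Gamma a * Real.Gamma b * Real.Gamma γ ^ n /
        Real.Gamma (a + b + n * γ)) * chamberIntegral n γ (a + γ) (b + γ) := by
  set R := {p : (Fin (n + 1) → ℝ) × (Fin n → ℝ) |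
    p.1 ∈ openChamber (n + 1) ∧ p.2 ∈ interlacing p.1} with hR
  let F : (Fin (n + 1) → ℝ) × (Fin n → ℝ) → ENNReal :=
    R.indicator fun p => ENNReal.ofReal (pairWeight γ a b p.1 p.2)
  have hF : Measurable F := by
    refine Measurable.indicator ?_ (measurableSet_interlacing_pairs n)
    unfold pairWeight gapProd
    fun_prop
  have hF1 : ∀ x y, (x, y) ∈ R → F (x, y) = ENNReal.ofReal (pairWeight γ a b x y) :=
    fun x y h => Set.indicator_of_mem h _
  have hF0 : ∀ x y, (x, y) ∉ R → F (x, y) = 0 := fun x y h => Set.indicator_of_notMem h _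
  have hleft : ENNReal.ofReal (Real.Gamma γ ^ (n + 1) / Real.Gamma ((n + 1) * γ)) *
      chamberIntegral (n + 1) γ a b = ∫⁻ x, ∫⁻ y, F (x, y) := by
    rw [chamberIntegral, ← lintegral_const_mul' _ _ ENNReal.ofReal_ne_top,
      ← lintegral_indicator (measurableSet_openChamber _)]
    refine lintegral_congr fun x => ?_
    by_cases hx : x ∈ openChamber (n + 1)
    · rw [Set.indicator_of_mem hx, ← lintegral_pairWeight_right hγ a b hx,
        ← lintegral_indicator (measurableSet_interlacing x)]
      refine lintegral_congr fun y => ?_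
      by_cases hy : y ∈ interlacing x
      · rw [Set.indicator_of_mem hy]
        exact (hF1 x y ⟨hx, hy⟩).symm
      · rw [Set.indicator_of_notMem hy]
        exact (hF0 x y fun h => hy h.2).symm
    · rw [Set.indicator_of_notMem hx, ← lintegral_zero]
      exact lintegral_congr fun y => (hF0 x y fun h => hx h.1).symm
  have hright : ENNReal.ofReal (Real.Gamma a * Real.Gamma b * Real.Gamma γ ^ n /
      Real.Gamma (a + b + n * γ)) * chamberIntegral n γ (a + γ) (b + γ) =
      ∫⁻ y, ∫⁻ x, F (x, y) := by
    rw [chamberIntegral, ← lintegral_const_mul' _ _ ENNReal.ofReal_ne_top,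
      ← lintegral_indicator (measurableSet_openChamber _)]
    refine lintegral_congr fun y => ?_
    by_cases hy : y ∈ openChamber n
    · rw [Set.indicator_of_mem hy, ← lintegral_pairWeight_left hγ ha hb hy,
        ← lintegral_indicator (measurableSet_interlacing _)]
      refine lintegral_congr fun x => ?_
      by_cases hx : x ∈ interlacing (withEndpoints y)
      · rw [Set.indicator_of_mem hx]
        exact (hF1 x y (mem_openChamber_and_mem_interlacing_iff.2 ⟨hy, hx⟩)).symm
      · rw [Set.indicator_of_notMem hx]
        exact (hF0 x y fun h =>
          hx (mem_openChamber_and_mem_interlacing_iff.1 h).2).symm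
    · rw [Set.indicator_of_notMem hy, ← lintegral_zero]
      exact lintegral_congr fun x => (hF0 x y fun h =>
        hy (mem_openChamber_and_mem_interlacing_iff.1 h).1).symm
  rw [hleft, hright]
  exact lintegral_lintegral_swap hF.aemeasurable

/-- Selberg's integral formula over a chamber. -/
theorem chamberIntegral_eq (n : ℕ) {γ a b : ℝ} (hγ : 0 < γ) (ha : 0 < a) (hb : 0 < b) :
    chamberIntegral n γ a b = ENNReal.ofReal (∏ j ∈ range n,
      Real.Gamma (a + j * γ) * Real.Gamma (b + j * γ) * Real.Gamma ((j + 1) * γ) /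
        (Real.Gamma (a + b + (n - 1 + j) * γ) * Real.Gamma γ)) := by
  induction n generalizing a b with
  | zero =>
    have h : openChamber 0 = Set.univ := by
      ext x
      simp [openChamber, StrictAnti]
    rw [chamberIntegral, h, Measure.restrict_univ, lintegral_unique]
    simp [gapProd, volume_pi]
  | succ n ih =>
    have h := chamberIntegral_succ n hγ ha hb
    have hΓ := Real.Gamma_pos_of_pos hγ
    have hΓa := Real.Gamma_pos_of_pos ha
    have hΓb := Real.Gamma_pos_of_pos hb
    have hΓn : 0 < Real.Gamma ((n + 1) * γ) := Real.Gamma_pos_of_pos (by positivity)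
    have hΓs : 0 < Real.Gamma (a + b + n * γ) := Real.Gamma_pos_of_pos (by positivity)
    have hc : 0 < Real.Gamma γ ^ (n + 1) / Real.Gamma ((n + 1) * γ) := by positivity
    rw [ih (add_pos ha hγ) (add_pos hb hγ), ← ENNReal.ofReal_mul (by positivity)] at h
    rw [← ENNReal.mul_right_inj (ENNReal.ofReal_pos.2 hc).ne' ENNReal.ofReal_ne_top, h,
      ← ENNReal.ofReal_mul hc.le]
    congr 1
    simp only [prod_div_distrib, prod_mul_distrib, prod_const, card_range]
    rw [prod_range_succ' (fun j : ℕ => Real.Gamma (a + j * γ)),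
      prod_range_succ' (fun j : ℕ => Real.Gamma (b + j * γ)),
      prod_range_succ (fun j : ℕ => Real.Gamma ((j + 1) * γ)),
      prod_range_succ' (fun j : ℕ => Real.Gamma (a + b + (((n + 1 : ℕ) : ℝ) - 1 + j) * γ))]
    have e1 : ∀ c : ℝ, ∀ j : ℕ, c + ((j + 1 : ℕ) : ℝ) * γ = c + γ + j * γ := by
      intro c j; push_cast; ring
    have e2 : ∀ j : ℕ, a + b + (((n + 1 : ℕ) : ℝ) - 1 + ((j + 1 : ℕ) : ℝ)) * γ =
        a + γ + (b + γ) + (n - 1 + j) * γ := by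
      intro j; push_cast; ring
    have e3 : a + b + (((n + 1 : ℕ) : ℝ) - 1) * γ = a + b + n * γ := by
      push_cast; ring
    simp only [e1, e2, e3, Nat.cast_zero, zero_mul, add_zero]
    have hne : ∏ j ∈ range n, Real.Gamma (a + γ + (b + γ) + ((n : ℝ) - 1 + j) * γ) ≠ 0 := by
      refine prod_ne_zero_iff.2 fun j hj => (Real.Gamma_pos_of_pos ?_).ne'
      have : (1 : ℝ) ≤ n := by exact_mod_cast (Nat.zero_le j).trans_lt (mem_range.1 hj)
      have : 0 ≤ ((n : ℝ) - 1 + j) * γ :=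
        mul_nonneg (add_nonneg (by linarith) (Nat.cast_nonneg j)) hγ.le
      positivity
    generalize ∏ j ∈ range n, Real.Gamma (a + γ + (b + γ) + ((n : ℝ) - 1 + j) * γ) = P at hne ⊢
    field_simp

lemma prod_Icc_one_eq_prod_range (f : ℕ → ℝ) (n : ℕ) :
    ∏ i ∈ Icc 1 n, f i = ∏ j ∈ range n, f (j + 1) := by
  induction n with
  | zero => simp
  | succ n ih => rw [prod_Icc_succ_top (by omega), ih, prod_range_succ]

lemma ae_forall_ne (n : ℕ) (c : ℝ) : ∀ᵐ x : Fin n → ℝ, ∀ i, x i ≠ c := by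
  refine ae_all_iff.2 fun i => ?_
  rw [volume_pi, ae_iff]
  simpa using Measure.pi_hyperplane (fun _ : Fin n => (volume : Measure ℝ)) i c

lemma measurableSet_closedChamber (n : ℕ) : MeasurableSet {x : Fin n → ℝ |
    (∀ i, x i ∈ Set.Icc (0 : ℝ) 1) ∧ ∀ i j : Fin n, i ≤ j → x j ≤ x i} := by
  have h : {x : Fin n → ℝ |
      (∀ i, x i ∈ Set.Icc (0 : ℝ) 1) ∧ ∀ i j : Fin n, i ≤ j → x j ≤ x i} =
      (⋂ i : Fin n, {x | x i ∈ Set.Icc (0 : ℝ) 1}) ∩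
        ⋂ i : Fin n, ⋂ j : Fin n, ⋂ _ : i ≤ j, {x | x j ≤ x i} := by
    ext x
    simp
  rw [h]
  exact (MeasurableSet.iInter fun i => measurable_pi_apply i measurableSet_Icc).inter
    (MeasurableSet.iInter fun i => MeasurableSet.iInter fun j => MeasurableSet.iInter
      fun _ => measurableSet_le (measurable_pi_apply j) (measurable_pi_apply i))

lemma setIntegral_closedChamber (n : ℕ) {γ : ℝ} (hγ : 0 < γ) :
    ∫ x in {x : Fin n → ℝ | (∀ i, x i ∈ Set.Icc (0 : ℝ) 1) ∧ ∀ i j : Fin n, i ≤ j → x j ≤ x i},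
        (∏ i : Fin n, ∏ j ∈ Ioi i, (x i - x j) ^ (2 * γ)) *
          ∏ i : Fin n, (x i * (1 - x i)) ^ (γ - 1) =
      (chamberIntegral n γ γ γ).toReal := by
  have hS := measurableSet_closedChamber n
  rw [integral_eq_lintegral_of_nonneg_ae]
  · congr 1
    rw [chamberIntegral, ← lintegral_indicator hS,
      ← lintegral_indicator (measurableSet_openChamber n)]
    refine lintegral_congr_ae ?_
    filter_upwards [ae_forall_ne n 0, ae_forall_ne n 1] with x hx0 hx1
    by_cases hx : x ∈ openChamber n
    · rw [Set.indicator_of_mem hx, Set.indicator_of_mem]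
      · congr 2
        · exact prod_prod_Ioi_sub_rpow hx.1 _
        · exact prod_congr rfl fun i _ =>
            Real.mul_rpow (hx.2 i).1.le (sub_pos.2 (hx.2 i).2).le
      · exact ⟨fun i => ⟨(hx.2 i).1.le, (hx.2 i).2.le⟩, fun i j hij => hx.1.antitone hij⟩
    · rw [Set.indicator_of_notMem hx, Set.indicator_apply_eq_zero]
      intro hxS
      have hnot : ¬ StrictAnti x := fun h => hx ⟨h, fun i =>
        ⟨lt_of_le_of_ne (hxS.1 i).1 (hx0 i).symm, lt_of_le_of_ne (hxS.1 i).2 (hx1 i)⟩⟩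
      simp only [StrictAnti, not_forall, not_lt] at hnot
      obtain ⟨i, j, hij, hle⟩ := hnot
      have heq : x i - x j = 0 := sub_eq_zero.2 (le_antisymm hle (hxS.2 i j hij.le))
      rw [prod_eq_zero (mem_univ i) (prod_eq_zero (mem_Ioi.2 hij)
        (by rw [heq, Real.zero_rpow (by positivity)])), zero_mul, ENNReal.ofReal_zero]
  · filter_upwards [ae_restrict_mem hS] with x hx
    exact mul_nonneg (prod_nonneg fun i _ => prod_nonneg fun j hj => Real.rpow_nonneg
      (sub_nonneg.2 (hx.2 i j (mem_Ioi.1 hj).le)) _) (prod_nonneg fun i _ => Real.rpow_nonneg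
      (mul_nonneg (hx.1 i).1 (sub_nonneg.2 (hx.1 i).2)) _)
  · exact Measurable.aestronglyMeasurable (by fun_prop)

/-- The Selberg-type evaluation: for `q ≥ 1` and `β > 0`,
`∏_{M=1}^q Γ(2/β)/Γ(2M/β)² · ∫_{1 ≥ x₁ ≥ ⋯ ≥ x_q ≥ 0} ∏_{i<j}(xᵢ−x_j)^{4/β}
 ∏_i [xᵢ(1−xᵢ)]^{2/β−1} dx = ∏_{i=1}^q Γ((2/β)i)/Γ((2/β)(q+i))`. -/
theorem selberg_interlacing_evaluation (q : ℕ) (hq : 1 ≤ q) (β : ℝ) (hβ : 0 < β) :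
    (∏ M ∈ Finset.Icc 1 q, Real.Gamma (2 / β) / Real.Gamma (2 * M / β) ^ 2) *
      ∫ x in {x : Fin q → ℝ |
          (∀ i, x i ∈ Set.Icc (0 : ℝ) 1) ∧ ∀ i j : Fin q, i ≤ j → x j ≤ x i},
        (∏ i : Fin q, ∏ j ∈ Finset.Ioi i, (x i - x j) ^ (4 / β)) *
          ∏ i : Fin q, (x i * (1 - x i)) ^ (2 / β - 1) =
      ∏ i ∈ Finset.Icc 1 q,
        Real.Gamma (2 / β * i) / Real.Gamma (2 / β * (q + i)) := by
  have hγ : 0 < 2 / β := by positivity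
  have h4 : 4 / β = 2 * (2 / β) := by ring
  simp_rw [h4]
  rw [setIntegral_closedChamber q hγ, chamberIntegral_eq q hγ hγ hγ]
  generalize hg : 2 / β = γ at hγ ⊢
  have h2 : ∀ M : ℕ, 2 * (M : ℝ) / β = M * γ := fun M => by rw [← hg]; ring
  have hpos : ∀ j ∈ range q, 0 < Real.Gamma (γ + γ + ((q : ℝ) - 1 + j) * γ) := fun j _ => by
    refine Real.Gamma_pos_of_pos ?_
    have : (1 : ℝ) ≤ q := by exact_mod_cast hq
    have : 0 ≤ ((q : ℝ) - 1 + j) * γ :=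
      mul_nonneg (add_nonneg (by linarith) (Nat.cast_nonneg j)) hγ.le
    positivity
  rw [ENNReal.toReal_ofReal]
  · rw [prod_Icc_one_eq_prod_range, prod_Icc_one_eq_prod_range, ← prod_mul_distrib]
    refine prod_congr rfl fun j hj => ?_
    have hΓ := Real.Gamma_pos_of_pos hγ
    have hΓj : 0 < Real.Gamma ((j + 1) * γ) := Real.Gamma_pos_of_pos (by positivity)
    have hΓq := hpos j hj
    rw [h2, Nat.cast_add_one, show γ * (q + (j + 1)) = γ + γ + ((q : ℝ) - 1 + j) * γ by ring,
      show γ + j * γ = (j + 1) * γ by ring, mul_comm γ ((j : ℝ) + 1)]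
    field_simp
  · refine prod_nonneg fun j hj => ?_
    have hΓ := Real.Gamma_pos_of_pos hγ
    have hΓj : 0 < Real.Gamma (γ + j * γ) := Real.Gamma_pos_of_pos (by positivity)
    have hΓj' : 0 < Real.Gamma ((j + 1) * γ) := Real.Gamma_pos_of_pos (by positivity)
    have hΓq := hpos j hj
    positivity
end

section
/- Let q ∈ ℕ, q ≥ 1, and 0 < β < 4q². Then the integral over {x ∈ [0,1]^{2q} : x_1 ≥ ··· ≥ x_{2q}, ∑_{i=1}^{2q} x_i = q} of ∏_{1≤i<j≤2q}(x_i−x_j)^{4/β} ∏_{i=1}^{2q}[x_i(1−x_i)]^{2/β−1}, with respect to (2q−1)-dimensional Lebesgue measure on the hyperplane, is finite. -/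
open MeasureTheory

theorem lintegral_pi_eq_lintegral_prod_insertNth {m : ℕ} (i : Fin (m + 1))
    (F : (Fin (m + 1) → ℝ) → ENNReal) :
    ∫⁻ y, F y = ∫⁻ z : ℝ × (Fin m → ℝ), F (i.insertNth z.1 z.2) := by
  have h := (volume_preserving_piFinSuccAbove (fun _ : Fin (m + 1) => ℝ) i).symm
  rw [← h.lintegral_comp_emb (MeasurableEquiv.measurableEmbedding _)]
  rfl

theorem lintegral_pi_prod_lt_top {m : ℕ} (f : Fin m → ℝ → ENNReal)
    (hf : ∀ i, Measurable (f i)) (hfin : ∀ i, ∫⁻ t, f i t < ⊤) :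
    ∫⁻ y : Fin m → ℝ, ∏ i, f i (y i) < ⊤ := by
  induction m with
  | zero => simp [lintegral_unique, volume_pi]
  | succ m ih =>
    rw [lintegral_pi_eq_lintegral_prod_insertNth 0]
    simp only [Fin.prod_univ_succAbove _ (0 : Fin (m + 1)), Fin.insertNth_apply_same,
      Fin.insertNth_apply_succAbove]
    have hF : Measurable fun y : Fin m → ℝ => ∏ j, f ((0 : Fin (m + 1)).succAbove j) (y j) :=
      Finset.measurable_prod _ fun i _ => by
        have := hf ((0 : Fin (m + 1)).succAbove i)
        fun_prop
    rw [Measure.volume_eq_prod, lintegral_prod_mul (hf 0).aemeasurable hF.aemeasurable]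
    exact ENNReal.mul_lt_top (hfin 0) (ih _ (fun i => hf _) fun i => hfin _)

theorem lintegral_pi_sub_sum_mul_prod_erase_lt_top {m : ℕ} (i₀ : Fin m) (c : ℝ)
    (g : ℝ → ENNReal) (hg : Measurable g) (hgfin : ∫⁻ t, g t < ⊤) (f : Fin m → ℝ → ENNReal)
    (hf : ∀ i, Measurable (f i)) (hfin : ∀ i, ∫⁻ t, f i t < ⊤) :
    ∫⁻ y : Fin m → ℝ, g (c - ∑ i, y i) * ∏ i ∈ Finset.univ.erase i₀, f i (y i) < ⊤ := by
  obtain _ | m := m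
  · exact i₀.elim0
  have hprod (F : Fin (m + 1) → ENNReal) :
      ∏ i ∈ Finset.univ.erase i₀, F i = ∏ j, F (i₀.succAbove j) := by
    rw [← Finset.compl_singleton, ← Fin.image_succAbove_univ,
      Finset.prod_image (fun _ _ _ _ h => Fin.succAbove_right_injective h)]
  simp only [hprod]
  have hF : Measurable fun y : Fin m → ℝ => ∏ j, f (i₀.succAbove j) (y j) :=
    Finset.measurable_prod _ fun i _ => by have := hf (i₀.succAbove i); fun_prop
  rw [lintegral_pi_eq_lintegral_prod_insertNth i₀]
  simp only [Fin.sum_univ_succAbove _ i₀, Fin.insertNth_apply_same, Fin.insertNth_apply_succAbove]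
  rw [Measure.volume_eq_prod, lintegral_prod_symm _ (by fun_prop)]
  have (y : Fin m → ℝ) : ∫⁻ t : ℝ, g (c - (t + ∑ j, y j)) * ∏ j, f (i₀.succAbove j) (y j)
      = (∫⁻ t, g t) * ∏ j, f (i₀.succAbove j) (y j) := by
    rw [lintegral_mul_const _ (by fun_prop), ← lintegral_sub_left_eq_self g (c - ∑ j, y j)]
    congr 2 with t
    congr 1
    ring
  simp only [this]
  rw [lintegral_const_mul _ hF]
  exact ENNReal.mul_lt_top hgfin (lintegral_pi_prod_lt_top _ (fun _ => hf _) fun _ => hfin _)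

theorem lintegral_indicator_Icc_rpow_lt_top {r : ℝ} (hr : -1 < r) :
    ∫⁻ t : ℝ, (Set.Icc (0 : ℝ) 1).indicator (fun t => ENNReal.ofReal t ^ r) t < ⊤ := by
  rw [lintegral_indicator measurableSet_Icc, ← restrict_Ioc_eq_restrict_Icc]
  have h := (intervalIntegrable_iff_integrableOn_Ioc_of_le zero_le_one).1
    (intervalIntegral.intervalIntegrable_rpow' (a := 0) (b := 1) hr)
  rw [setLIntegral_congr_fun measurableSet_Ioc
    (g := fun t => ENNReal.ofReal (t ^ r)) fun t ht => ENNReal.ofReal_rpow_of_pos ht.1]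
  exact h.lintegral_lt_top

theorem rpow_le_rpow_abs_mul_rpow {w M L : ℝ} (hM : 0 < M) (hL : 1 ≤ L)
    (h₁ : w ≤ L * M) (h₂ : M ≤ L * w) (p : ℝ) : w ^ p ≤ L ^ |p| * M ^ p := by
  have hL0 : 0 < L := by linarith
  have hw : 0 < w := pos_of_mul_pos_right (hM.trans_le h₂) hL0.le
  rcases le_total 0 p with hp | hp
  · rw [abs_of_nonneg hp, ← Real.mul_rpow hL0.le hM.le]
    exact Real.rpow_le_rpow hw.le h₁ hp
  · have h : w ^ p ≤ (L⁻¹ * M) ^ p :=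
      Real.rpow_le_rpow_of_nonpos (by positivity) (by rw [inv_mul_le_iff₀ hL0]; exact h₂) hp
    rwa [Real.mul_rpow (by positivity) hM.le, Real.inv_rpow hL0.le, ← Real.rpow_neg hL0.le,
      ← abs_of_nonpos hp] at h

/-- A product of powers of comparable variables is controlled by a product of powers `ε - 1` that
omits one variable, once the total exponent is large enough. -/
theorem prod_rpow_sub_one_le {ι : Type*} [Fintype ι] [DecidableEq ι] (s : ι → ℝ) {ε L : ℝ}
    (hL : 1 ≤ L) (hs : ∀ i, ε ≤ s i) (i₀ i₁ : ι)
    (hsum : 1 ≤ s i₀ + ∑ i ∈ Finset.univ.erase i₀, (s i - ε)) (w : ι → ℝ)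
    (hw : ∀ i, 0 < w i) (hle : ∀ i, w i ≤ L * w i₁) (hge : w i₁ ≤ L * w i₀) (h1 : w i₁ ≤ 1) :
    ∏ i, w i ^ (s i - 1) ≤
      (L ^ |s i₀ - 1| * ∏ i ∈ Finset.univ.erase i₀, L ^ (s i - ε)) *
        ∏ i ∈ Finset.univ.erase i₀, w i ^ (ε - 1) := by
  have hL0 : 0 < L := by linarith
  set M := w i₁
  have hM : 0 < M := hw i₁
  have key (i : ι) : w i ^ (s i - 1) ≤ L ^ (s i - ε) * M ^ (s i - ε) * w i ^ (ε - 1) := by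
    rw [← Real.mul_rpow hL0.le hM.le, show s i - 1 = (s i - ε) + (ε - 1) by ring,
      Real.rpow_add (hw i)]
    have := Real.rpow_le_rpow (hw i).le (hle i) (sub_nonneg.2 (hs i))
    have := Real.rpow_nonneg (hw i).le (ε - 1)
    gcongr
  have hpow : M ^ (s i₀ - 1) * ∏ i ∈ Finset.univ.erase i₀, M ^ (s i - ε) ≤ 1 := by
    rw [← Real.rpow_sum_of_pos hM, ← Real.rpow_add hM]
    exact Real.rpow_le_one hM.le h1 (by linarith)
  rw [← Finset.mul_prod_erase _ _ (Finset.mem_univ i₀)]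
  have hP : 0 ≤ ∏ i ∈ Finset.univ.erase i₀, w i ^ (ε - 1) :=
    Finset.prod_nonneg fun i _ => Real.rpow_nonneg (hw i).le _
  have hC : 0 ≤ L ^ |s i₀ - 1| * ∏ i ∈ Finset.univ.erase i₀, L ^ (s i - ε) :=
    mul_nonneg (by positivity) (Finset.prod_nonneg fun i _ => by positivity)
  calc w i₀ ^ (s i₀ - 1) * ∏ i ∈ Finset.univ.erase i₀, w i ^ (s i - 1)
      ≤ (L ^ |s i₀ - 1| * M ^ (s i₀ - 1)) *
          ∏ i ∈ Finset.univ.erase i₀, L ^ (s i - ε) * M ^ (s i - ε) * w i ^ (ε - 1) :=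
        mul_le_mul (rpow_le_rpow_abs_mul_rpow hM hL (hle i₀) hge _)
          (Finset.prod_le_prod (fun i _ => Real.rpow_nonneg (hw i).le _) fun i _ => key i)
          (Finset.prod_nonneg fun i _ => Real.rpow_nonneg (hw i).le _) (by positivity)
    _ = (L ^ |s i₀ - 1| * ∏ i ∈ Finset.univ.erase i₀, L ^ (s i - ε)) *
          (M ^ (s i₀ - 1) * ∏ i ∈ Finset.univ.erase i₀, M ^ (s i - ε)) *
          ∏ i ∈ Finset.univ.erase i₀, w i ^ (ε - 1) := by
        simp only [Finset.prod_mul_distrib]; ring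
    _ ≤ _ := by
        refine mul_le_mul_of_nonneg_right ?_ hP
        exact mul_le_of_le_one_right hC hpow

/-- The distance of the `i`-th of `2q` decreasing coordinates to the endpoint of `[0, 1]` it is
allowed to approach: `1` for the first `q` coordinates and `0` for the others. -/
def endpointDist (q i : ℕ) (t : ℝ) : ℝ := if i < q then 1 - t else t

/-- The position of the index `i` counted from the nearest end of `{0, …, 2q - 1}`. -/
def endRank (q i : ℕ) : ℕ := if i < q then i else 2 * q - 1 - i

theorem endpointDist_mem_Icc (q i : ℕ) {t : ℝ} (ht : t ∈ Set.Icc (0 : ℝ) 1) :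
    endpointDist q i t ∈ Set.Icc (0 : ℝ) 1 := by
  obtain ⟨h₀, h₁⟩ := ht
  unfold endpointDist
  split_ifs <;> constructor <;> linarith

theorem endpointDist_mul_one_sub (q i : ℕ) (t : ℝ) :
    endpointDist q i t * (1 - endpointDist q i t) = t * (1 - t) := by
  unfold endpointDist
  split_ifs <;> ring

theorem sum_two_mul_endRank_add_one (q : ℕ) :
    ∑ i : Fin (2 * q), (2 * (endRank q i : ℝ) + 1) = 2 * (q : ℝ) ^ 2 := by
  rw [Fin.sum_univ_eq_sum_range (fun i => 2 * (endRank q i : ℝ) + 1), two_mul q,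
    Finset.sum_range_add]
  have hodd (p : ℕ) : ∑ i ∈ Finset.range p, (2 * (i : ℝ) + 1) = (p : ℝ) ^ 2 := by
    induction p with
    | zero => simp
    | succ p ih => rw [Finset.sum_range_succ, ih]; push_cast; ring
  have h₁ : ∑ i ∈ Finset.range q, (2 * (endRank q i : ℝ) + 1) = (q : ℝ) ^ 2 := by
    rw [← hodd q]
    refine Finset.sum_congr rfl fun i hi => ?_
    simp [endRank, Finset.mem_range.1 hi]
  have h₂ : ∑ i ∈ Finset.range q, (2 * (endRank q (q + i) : ℝ) + 1) = (q : ℝ) ^ 2 := by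
    rw [← hodd q, ← Finset.sum_range_reflect]
    refine Finset.sum_congr rfl fun i hi => ?_
    have := Finset.mem_range.1 hi
    rw [endRank, if_neg (by omega), show 2 * q - 1 - (q + (q - 1 - i)) = i by omega]
  rw [h₁, h₂]
  ring

theorem sum_fin_ite_lt {n p : ℕ} (hp : p ≤ n) (c : ℝ) :
    ∑ k : Fin n, (if (k : ℕ) < p then c else 0) = p * c := by
  rw [Fin.sum_univ_eq_sum_range (fun k => if k < p then c else 0), ← Finset.sum_filter,
    Finset.sum_const, nsmul_eq_mul]
  congr 2
  rw [show (Finset.range n).filter (· < p) = Finset.range p by ext; simp; omega,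
    Finset.card_range]

theorem inv_le_one_sub_endpointDist {q n : ℕ} (hn : n = 2 * q) {x : Fin n → ℝ}
    (hx : ∀ i, x i ∈ Set.Icc (0 : ℝ) 1) (hanti : Antitone x) (hsum : ∑ i, x i = q)
    (i : Fin n) :
    ((q : ℝ) + 1)⁻¹ ≤ 1 - endpointDist q i (x i) := by
  have hi := i.isLt
  subst hn
  rw [inv_le_iff_one_le_mul₀ (by positivity)]
  unfold endpointDist
  split_ifs with h
  · have hle : ∑ k, x k ≤
        ∑ k : Fin (2 * q), (x i + if (k : ℕ) < q - 1 then 1 - x i else 0) := by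
      refine Finset.sum_le_sum fun k _ => ?_
      split_ifs with hk
      · linarith [(hx k).2]
      · linarith [hanti (show i ≤ k by rw [Fin.le_def]; omega)]
    rw [Finset.sum_add_distrib, sum_fin_ite_lt (by omega), hsum, Nat.cast_sub (by omega)] at hle
    simp at hle
    linarith
  · have hge : ∑ k : Fin (2 * q), (if (k : ℕ) < q + 1 then x i else 0) ≤ ∑ k, x k := by
      refine Finset.sum_le_sum fun k _ => ?_
      split_ifs with hk
      · exact hanti (show k ≤ i by rw [Fin.le_def]; omega)
      · exact (hx k).1
    rw [sum_fin_ite_lt (by omega), hsum] at hge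
    push_cast at hge
    linarith

theorem endpointDist_le_mul {q n : ℕ} (hn : n = 2 * q) {x : Fin n → ℝ}
    (hx : ∀ i, x i ∈ Set.Icc (0 : ℝ) 1) (hanti : Antitone x) (hsum : ∑ i, x i = q)
    (i i₁ : Fin n) (hi₁ : (i₁ : ℕ) = q) :
    endpointDist q i (x i) ≤ q * endpointDist q i₁ (x i₁) := by
  have hi := i₁.isLt
  have hq : (1 : ℝ) ≤ q := by exact_mod_cast (by omega : 1 ≤ q)
  subst hn
  have h₁ : endpointDist q i₁ (x i₁) = x i₁ := by simp [endpointDist, hi₁]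
  rw [h₁, endpointDist]
  split_ifs with h
  · have hle : ∑ k, x k ≤ ∑ k : Fin (2 * q), (x i₁ + (if (k : ℕ) < q then 1 - x i₁ else 0)
        - if k = i then 1 - x i else 0) := by
      refine Finset.sum_le_sum fun k _ => ?_
      split_ifs with hk hk' hk'
      · subst hk'; linarith
      · linarith [(hx k).2]
      · subst hk'; omega
      · linarith [hanti (show i₁ ≤ k by rw [Fin.le_def]; omega)]
    rw [Finset.sum_sub_distrib, Finset.sum_add_distrib, sum_fin_ite_lt (by omega), hsum] at hle
    simp at hle
    linarith
  · have := hanti (show i₁ ≤ i by rw [Fin.le_def]; omega)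
    nlinarith [(hx i₁).1]

theorem endpointDist_le_mul_pred {q n : ℕ} (hn : n = 2 * q) {x : Fin n → ℝ}
    (hx : ∀ i, x i ∈ Set.Icc (0 : ℝ) 1) (hanti : Antitone x) (hsum : ∑ i, x i = q)
    (i₀ i₁ : Fin n) (hi₀ : (i₀ : ℕ) + 1 = q) (hi₁ : (i₁ : ℕ) = q) :
    endpointDist q i₁ (x i₁) ≤ q * endpointDist q i₀ (x i₀) := by
  subst hn
  have h₁ : endpointDist q i₁ (x i₁) = x i₁ := by simp [endpointDist, hi₁]
  have h₀ : endpointDist q i₀ (x i₀) = 1 - x i₀ := by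
    rw [endpointDist, if_pos (by omega)]
  rw [h₀, h₁]
  have hge : ∑ k : Fin (2 * q), ((if (k : ℕ) < q then x i₀ else 0)
      + if k = i₁ then x i₁ else 0) ≤ ∑ k, x k := by
    refine Finset.sum_le_sum fun k _ => ?_
    split_ifs with hk hk' hk'
    · subst hk'; omega
    · linarith [hanti (show k ≤ i₀ by rw [Fin.le_def]; omega)]
    · subst hk'; linarith
    · linarith [(hx k).1]
  rw [Finset.sum_add_distrib, sum_fin_ite_lt (by omega), hsum] at hge
  simp at hge
  linarith

theorem prod_sub_rpow_le {q n : ℕ} (hn : n = 2 * q) {x : Fin n → ℝ}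
    (hx : ∀ i, x i ∈ Set.Icc (0 : ℝ) 1) (hanti : Antitone x)
    {b : ℝ} (hb : 0 ≤ b) :
    ∏ i, ∏ j ∈ Finset.Ioi i, (x i - x j) ^ b ≤
      ∏ i : Fin n, (endpointDist q i (x i) ^ b) ^ endRank q i := by
  have hpair (i j : Fin n) (hij : i < j) : (x i - x j) ^ b ≤
      (if (j : ℕ) < q then endpointDist q j (x j) ^ b else 1) *
        (if (i : ℕ) < q then 1 else endpointDist q i (x i) ^ b) := by
    have h0 : 0 ≤ x i - x j := sub_nonneg.2 (hanti hij.le)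
    have hij' : (i : ℕ) < j := hij
    split_ifs with h₁ h₂ h₂
    · rw [mul_one, endpointDist, if_pos h₁]
      exact Real.rpow_le_rpow h0 (by linarith [(hx i).2]) hb
    · omega
    · rw [mul_one]
      exact Real.rpow_le_one h0 (by linarith [(hx i).2, (hx j).1]) hb
    · rw [one_mul, endpointDist, if_neg h₂]
      exact Real.rpow_le_rpow h0 (by linarith [(hx j).1]) hb
  calc ∏ i, ∏ j ∈ Finset.Ioi i, (x i - x j) ^ b
      ≤ ∏ i : Fin n, ∏ j ∈ Finset.Ioi i,
        (if (j : ℕ) < q then endpointDist q j (x j) ^ b else 1) *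
          (if (i : ℕ) < q then 1 else endpointDist q i (x i) ^ b) :=
        Finset.prod_le_prod (fun i _ => Finset.prod_nonneg fun j hj =>
            Real.rpow_nonneg (sub_nonneg.2 (hanti (Finset.mem_Ioi.1 hj).le)) _)
          fun i _ => Finset.prod_le_prod (fun j hj =>
            Real.rpow_nonneg (sub_nonneg.2 (hanti (Finset.mem_Ioi.1 hj).le)) _)
          fun j hj => hpair i j (Finset.mem_Ioi.1 hj)
    _ = _ := by
        simp only [Finset.prod_mul_distrib]
        rw [Finset.prod_comm' (s' := fun j => Finset.Iio j) (t' := Finset.univ) (by simp),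
          ← Finset.prod_mul_distrib]
        refine Finset.prod_congr rfl fun i _ => ?_
        rw [Finset.prod_const, Finset.prod_const, Fin.card_Iio, Fin.card_Ioi, endRank]
        split_ifs
        · simp
        · simp [hn]

theorem integrand_le {q n : ℕ} (hn : n = 2 * q) {x : Fin n → ℝ}
    (hx : ∀ i, x i ∈ Set.Icc (0 : ℝ) 1) (hanti : Antitone x) (hsum : ∑ i, x i = q)
    {a : ℝ} (ha : 0 ≤ a) (hpos : ∀ i : Fin n, 0 < endpointDist q i (x i)) :
    (∏ i, ∏ j ∈ Finset.Ioi i, (x i - x j) ^ (2 * a)) * ∏ i, (x i * (1 - x i)) ^ (a - 1) ≤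
      ((q : ℝ) + 1) ^ (|a - 1| * n) *
        ∏ i : Fin n, endpointDist q i (x i) ^ (a * (2 * (endRank q i : ℝ) + 1) - 1) := by
  have hend (i : Fin n) : (x i * (1 - x i)) ^ (a - 1) ≤
      ((q : ℝ) + 1) ^ |a - 1| * endpointDist q i (x i) ^ (a - 1) := by
    have h := inv_le_one_sub_endpointDist hn hx hanti hsum i
    have h0 : 0 < ((q : ℝ) + 1)⁻¹ := by positivity
    rw [← endpointDist_mul_one_sub q i, Real.mul_rpow (hpos i).le (h0.le.trans h), mul_comm]
    refine mul_le_mul_of_nonneg_right ?_ (Real.rpow_nonneg (hpos i).le _)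
    rw [inv_le_iff_one_le_mul₀ (by positivity)] at h
    have := rpow_le_rpow_abs_mul_rpow (w := 1 - endpointDist q i (x i)) (M := 1)
      (L := (q : ℝ) + 1) one_pos (by linarith [(Nat.cast_nonneg q : (0 : ℝ) ≤ q)])
      (by linarith [hpos i, (Nat.cast_nonneg q : (0 : ℝ) ≤ q)]) (by linarith) (a - 1)
    simpa using this
  calc _ ≤ (∏ i : Fin n, (endpointDist q i (x i) ^ (2 * a)) ^ endRank q i) *
        ∏ i : Fin n, ((q : ℝ) + 1) ^ |a - 1| * endpointDist q i (x i) ^ (a - 1) :=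
        mul_le_mul (prod_sub_rpow_le hn hx hanti (by linarith))
          (Finset.prod_le_prod (fun i _ => Real.rpow_nonneg
            (mul_nonneg (hx i).1 (sub_nonneg.2 (hx i).2)) _) fun i _ => hend i)
          (Finset.prod_nonneg fun i _ => Real.rpow_nonneg
            (mul_nonneg (hx i).1 (sub_nonneg.2 (hx i).2)) _)
          (Finset.prod_nonneg fun i _ => pow_nonneg (Real.rpow_nonneg (hpos i).le _) _)
    _ = _ := by
        rw [Finset.prod_mul_distrib, mul_left_comm, ← Finset.prod_mul_distrib, Finset.prod_const,
          Finset.card_univ, Fintype.card_fin, ← Real.rpow_mul_natCast (by positivity)]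
        congr 1
        refine Finset.prod_congr rfl fun i _ => ?_
        rw [← Real.rpow_mul_natCast (hpos i).le, ← Real.rpow_add (hpos i)]
        congr 1
        ring

/-- On the constrained ordered simplex the integrand is dominated by an integrable product which
omits the coordinate of index `q - 1`. -/
theorem exists_integrand_le_prod_erase {q n : ℕ} (hn : n = 2 * q) {a : ℝ} (ha : 0 < a)
    (haq : 1 < 2 * a * (q : ℝ) ^ 2) (i₀ : Fin n) (hi₀ : (i₀ : ℕ) + 1 = q) :
    ∃ ε > (0 : ℝ), ∃ C : ℝ, ∀ x : Fin n → ℝ, (∀ i, x i ∈ Set.Icc (0 : ℝ) 1) → Antitone x →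
      ∑ i, x i = q →
      ENNReal.ofReal ((∏ i, ∏ j ∈ Finset.Ioi i, (x i - x j) ^ (2 * a)) *
        ∏ i, (x i * (1 - x i)) ^ (a - 1)) ≤
      ENNReal.ofReal C *
        ∏ i ∈ Finset.univ.erase i₀, ENNReal.ofReal (endpointDist q i (x i)) ^ (ε - 1) := by
  have hq : (1 : ℝ) ≤ q := by exact_mod_cast (by omega : 1 ≤ q)
  let i₁ : Fin n := ⟨q, by omega⟩
  let s : Fin n → ℝ := fun i => a * (2 * (endRank q i : ℝ) + 1)
  set ε : ℝ := min (1 / 2) (min a ((2 * a * (q : ℝ) ^ 2 - 1) / (2 * q))) with hε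
  have hε0 : 0 < ε := lt_min (by norm_num) (lt_min ha (div_pos (by linarith) (by linarith)))
  have hε1 : ε < 1 := (min_le_left _ _).trans_lt (by norm_num)
  have hεa : ε ≤ a := (min_le_right _ _).trans (min_le_left _ _)
  have hεq : ε * (2 * q) ≤ 2 * a * (q : ℝ) ^ 2 - 1 :=
    (le_div_iff₀ (by linarith)).1 ((min_le_right _ _).trans (min_le_right _ _))
  have hs (i : Fin n) : ε ≤ s i := by
    have : 0 ≤ a * endRank q i := by positivity
    simp only [s]
    linarith
  have htot : 1 ≤ s i₀ + ∑ i ∈ Finset.univ.erase i₀, (s i - ε) := by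
    have h := Finset.add_sum_erase Finset.univ (fun i => s i - ε) (Finset.mem_univ i₀)
    have hsum : ∑ i, (s i - ε) = a * (2 * (q : ℝ) ^ 2) - 2 * q * ε := by
      subst hn
      rw [Finset.sum_sub_distrib, ← sum_two_mul_endRank_add_one, Finset.mul_sum]
      simp [s]
    linarith
  let D : ℝ := (q : ℝ) ^ |s i₀ - 1| * ∏ i ∈ Finset.univ.erase i₀, (q : ℝ) ^ (s i - ε)
  have hD : 0 < D := mul_pos (by positivity) (Finset.prod_pos fun i _ => by positivity)
  refine ⟨ε, hε0, ((q : ℝ) + 1) ^ (|a - 1| * n) * D, fun x hx hanti hsum => ?_⟩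
  by_cases hpos : ∀ i : Fin n, 0 < endpointDist q i (x i)
  · simp only [ENNReal.ofReal_rpow_of_pos (hpos _)]
    rw [← ENNReal.ofReal_prod_of_nonneg fun i _ => Real.rpow_nonneg (hpos i).le _,
      ← ENNReal.ofReal_mul (by positivity)]
    refine ENNReal.ofReal_le_ofReal ((integrand_le hn hx hanti hsum ha.le hpos).trans ?_)
    rw [mul_assoc]
    refine mul_le_mul_of_nonneg_left ?_ (by positivity)
    exact prod_rpow_sub_one_le s hq hs i₀ i₁ htot (fun i => endpointDist q i (x i)) hpos
      (fun i => endpointDist_le_mul hn hx hanti hsum i i₁ rfl)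
      (endpointDist_le_mul_pred hn hx hanti hsum i₀ i₁ hi₀ rfl)
      (endpointDist_mem_Icc q _ (hx i₁)).2
  · obtain ⟨i, hi, hi0⟩ : ∃ i : Fin n, i ≠ i₀ ∧ endpointDist q i (x i) ≤ 0 := by
      push Not at hpos
      obtain ⟨i, hi⟩ := hpos
      by_cases h : i = i₀
      · subst h
        refine ⟨i₁, fun h => ?_, ?_⟩
        · have := congrArg Fin.val h
          simp only [i₁] at this
          omega
        · have := endpointDist_le_mul_pred hn hx hanti hsum i i₁ hi₀ rfl
          nlinarith
      · exact ⟨i, h, hi⟩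
    have htop : ∏ i ∈ Finset.univ.erase i₀,
        ENNReal.ofReal (endpointDist q i (x i)) ^ (ε - 1) = ⊤ := by
      rw [← Finset.mul_prod_erase _ _ (Finset.mem_erase.2 ⟨hi, Finset.mem_univ i⟩),
        ENNReal.ofReal_of_nonpos hi0, ENNReal.zero_rpow_of_neg (by linarith)]
      refine ENNReal.top_mul (Finset.prod_ne_zero_iff.2 fun j _ => ?_)
      simp [ENNReal.rpow_eq_zero_iff, hε1.le]
    rw [htop, ENNReal.mul_top (ENNReal.ofReal_pos.2 (by positivity)).ne']
    exact le_top

theorem constrained_integral_lt_top_of_dim {q m n : ℕ} (hn : n = 2 * q) (hm : m = 2 * q - 1)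
    (hq : 1 ≤ q) {a : ℝ} (ha : 0 < a) (haq : 1 < 2 * a * (q : ℝ) ^ 2)
    (X : (Fin m → ℝ) → Fin n → ℝ)
    (hX : ∀ y i, X y i = if h : (i : ℕ) < m then y ⟨i, h⟩ else (q : ℝ) - ∑ j, y j) :
    ∫⁻ y in {y : Fin m → ℝ |
        (∀ i, X y i ∈ Set.Icc (0 : ℝ) 1) ∧ ∀ i j : Fin n, i ≤ j → X y j ≤ X y i},
      ENNReal.ofReal ((∏ i, ∏ j ∈ Finset.Ioi i, (X y i - X y j) ^ (2 * a)) *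
        ∏ i, (X y i * (1 - X y i)) ^ (a - 1)) < ⊤ := by
  obtain rfl : n = m + 1 := by omega
  let i₀ : Fin m := ⟨q - 1, by omega⟩
  have hcast (y : Fin m → ℝ) (i : Fin m) : X y i.castSucc = y i := by simp [hX]
  have hlast (y : Fin m → ℝ) : X y (Fin.last m) = q - ∑ j, y j := by simp [hX]
  obtain ⟨ε, hε, C, hC⟩ := exists_integrand_le_prod_erase hn ha haq i₀.castSucc
    (by simp only [i₀, Fin.val_castSucc]; omega)
  let g : ℝ → ENNReal := (Set.Icc (0 : ℝ) 1).indicator fun t => ENNReal.ofReal t ^ (ε - 1)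
  have hg : Measurable g := Measurable.indicator (by fun_prop) measurableSet_Icc
  have hgfin : ∫⁻ t, g t < ⊤ := lintegral_indicator_Icc_rpow_lt_top (by linarith)
  let f : Fin m → ℝ → ENNReal := fun i t => g (endpointDist q i t)
  have hf (i : Fin m) : Measurable (f i) := by
    simp only [f, endpointDist]
    split_ifs <;> fun_prop
  have hfin (i : Fin m) : ∫⁻ t, f i t < ⊤ := by
    simp only [f, endpointDist]
    split_ifs
    · rwa [lintegral_sub_left_eq_self g]
    · exact hgfin
  have hG : Measurable fun y : Fin m → ℝ =>
      g (q - ∑ i, y i) * ∏ i ∈ Finset.univ.erase i₀, f i (y i) :=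
    (by fun_prop : Measurable fun y : Fin m → ℝ => g (q - ∑ i, y i)).mul
      (Finset.measurable_prod _ fun i _ => by have := hf i; fun_prop)
  refine (setLIntegral_mono (hG.const_mul (ENNReal.ofReal C)) fun y hy => ?_).trans_lt
    ((setLIntegral_le_lintegral _ _).trans_lt ?_)
  · refine (hC (X y) hy.1 (fun i j h => hy.2 i j h) ?_).trans_eq ?_
    · rw [Fin.sum_univ_castSucc]
      simp [hcast, hlast]
    · congr 1
      have hgX (i : Fin (m + 1)) : ENNReal.ofReal (endpointDist q i (X y i)) ^ (ε - 1) =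
          g (endpointDist q i (X y i)) :=
        (Set.indicator_of_mem (endpointDist_mem_Icc q i (hy.1 i))
          fun t => ENNReal.ofReal t ^ (ε - 1)).symm
      have hset : (Finset.univ.erase i₀.castSucc : Finset (Fin (m + 1))) =
          Finset.cons (Fin.last m) ((Finset.univ.erase i₀).map Fin.castSuccEmb) (by simp) := by
        ext i
        refine Fin.lastCases ?_ (fun i => ?_) i
        · simp [(Fin.castSucc_lt_last i₀).ne']
        · simp [(Fin.castSucc_lt_last i).ne]
      rw [Finset.prod_congr rfl fun i _ => hgX i, hset, Finset.prod_cons, Finset.prod_map]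
      have hm' : ¬ m < q := by omega
      simp [hcast, hlast, f, endpointDist, hm']
  · rw [lintegral_const_mul _ hG]
    exact ENNReal.mul_lt_top ENNReal.ofReal_lt_top
      (lintegral_pi_sub_sum_mul_prod_erase_lt_top i₀ q g hg hgfin f hf hfin)

/-- For `q ≥ 1` and `0 < β < 4q²`, the integral over
`{x ∈ [0,1]^{2q} : x₁ ≥ ⋯ ≥ x_{2q}, ∑ xᵢ = q}` of
`∏_{i<j}(xᵢ−x_j)^{4/β} ∏_i [xᵢ(1−xᵢ)]^{2/β−1}`, with respect to the
`(2q−1)`-dimensional Lebesgue measure on the hyperplane (parametrized by the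
first `2q−1` coordinates, the last being determined by the sum constraint),
is finite. -/
theorem constrained_integral_lt_top (q : ℕ) (hq : 1 ≤ q) (β : ℝ)
    (hβ0 : 0 < β) (hβ : β < 4 * (q : ℝ) ^ 2)
    (X : (Fin (2 * q - 1) → ℝ) → Fin (2 * q) → ℝ)
    (hX : ∀ y i, X y i =
      if h : (i : ℕ) < 2 * q - 1 then y ⟨i, h⟩ else (q : ℝ) - ∑ j, y j) :
    ∫⁻ y in {y : Fin (2 * q - 1) → ℝ |
        (∀ i, X y i ∈ Set.Icc (0 : ℝ) 1) ∧
          ∀ i j : Fin (2 * q), i ≤ j → X y j ≤ X y i},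
      ENNReal.ofReal
        ((∏ i : Fin (2 * q), ∏ j ∈ Finset.Ioi i, (X y i - X y j) ^ (4 / β)) *
          ∏ i : Fin (2 * q), (X y i * (1 - X y i)) ^ (2 / β - 1)) < ⊤ := by
  have h := constrained_integral_lt_top_of_dim (a := 2 / β) rfl rfl hq (by positivity)
    (by rw [mul_div_assoc', div_mul_eq_mul_div, one_lt_div hβ0]; linarith) X hX
  rwa [show 2 * (2 / β) = 4 / β by ring] at h
end
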